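/- arXiv:1412.5781 — 3 statements merged into one kernel-verified Lean document; each statement's English description precedes it below -/
import Mathlib

section
/- If the theory T is NIP, then for every D ⊆ U^{|z|} the following are equivalent: (1) D is approximable from below (in particular, externally definable); (2) e(D) has finite VC-dimension. -/
namespace Paper

open FirstOrder Language Cardinal Set

universe u

variable (L : FirstOrder.Language.{u, u}) (U : Type u) [iS : L.Structure U]

/-- A language consisting of a single `n`-ary relation symbol. -/
def predLang (n : ℕ) : FirstOrder.Language.{u, u} where
  Functions := fun _ => PEmpty
  Relations := fun m => ULift (PLift (m = n))

/-- The language `L` together with one new `n`-ary relation symbol. -/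
def expLang (n : ℕ) : FirstOrder.Language.{u, u} := L.sum (predLang n)

/-- The expansion `⟨U, D⟩` of `U` by a predicate for `D ⊆ U^n`. -/
def expStr {n : ℕ} (D : Set (Fin n → U)) : (expLang L n).Structure U where
  funMap := fun {_} f x =>
    match f with
    | Sum.inl f => Structure.funMap f x
    | Sum.inr f => f.elim
  RelMap := fun {_} r x =>
    match r with
    | Sum.inl r => Structure.RelMap r x
    | Sum.inr h => (x ∘ Fin.cast h.down.down.symm) ∈ D

/-- Add the elements of `A : Set U` as constants to an arbitrary structure on `U`. -/
def addConsts {L' : FirstOrder.Language.{u, u}} (S : L'.Structure U) (A : Set U) :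
    (L'[[↥A]]).Structure U :=
  letI := S
  letI : (constantsOn ↥A).Structure U := constantsOn.structure Subtype.val
  Language.sumStructure _ _ _

/-- Add all elements of `U` as constants to an arbitrary structure on `U`. -/
def addAllConsts {L' : FirstOrder.Language.{u, u}} (S : L'.Structure U) :
    (L'[[U]]).Structure U :=
  letI := S
  letI : (constantsOn U).Structure U := constantsOn.structure id
  Language.sumStructure _ _ _

/-- Realization of a formula with respect to an explicitly given structure. -/
def FRealize {L' : FirstOrder.Language.{u, u}} (S : L'.Structure U) {α : Type*}
    (φ : L'.Formula α) (v : α → U) : Prop :=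
  @Formula.Realize L' U S α φ v

/-- Realization of a sentence with respect to an explicitly given structure. -/
def SentRealize {L' : FirstOrder.Language.{u, u}} (S : L'.Structure U) (φ : L'.Sentence) : Prop :=
  @Sentence.Realize L' U S φ

/-- A structure on `U` is saturated if every type over a parameter set of cardinality `< #U`
which is finitely realized is realized. -/
def IsSatStr {L' : FirstOrder.Language.{u, u}} (S : L'.Structure U) : Prop :=
  ∀ A : Set U, #A < #U → ∀ (m : ℕ) (p : Set ((L'[[↥A]]).Formula (Fin m))),
    (∀ s : Finset ((L'[[↥A]]).Formula (Fin m)), ↑s ⊆ p →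
      ∃ b : Fin m → U, ∀ φ ∈ s, FRealize U (addConsts U S A) φ b) →
    ∃ b : Fin m → U, ∀ φ ∈ p, FRealize U (addConsts U S A) φ b

/-- `D ⊆ U^n` is saturated if the expansion `⟨U, D⟩` is a saturated structure. -/
def SatSet {n : ℕ} (D : Set (Fin n → U)) : Prop :=
  IsSatStr U (expStr L U D)

/-- `⟨U,C⟩ ≡_A ⟨U,D⟩` : the two expansions satisfy the same sentences with parameters in `A`. -/
def EqvOver {n : ℕ} (A : Set U) (C D : Set (Fin n → U)) : Prop :=
  ∀ φ : ((expLang L n)[[↥A]]).Sentence,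
    SentRealize U (addConsts U (expStr L U C) A) φ ↔
      SentRealize U (addConsts U (expStr L U D) A) φ

/-- `e(D/A)`, the class of all `C` with `⟨U,C⟩ ≡_A ⟨U,D⟩`. -/
def eSet {n : ℕ} (A : Set U) (D : Set (Fin n → U)) : Set (Set (Fin n → U)) :=
  {C | EqvOver L U A C D}

/-- The group `Aut(U/A)` of automorphisms of `U` fixing `A` pointwise (as a set). -/
def AutFix (A : Set U) : Set (U ≃[L] U) :=
  {f | ∀ a ∈ A, f a = a}

/-- The image of a set of tuples under an automorphism. -/
def imgSet {n : ℕ} (f : U ≃[L] U) (D : Set (Fin n → U)) : Set (Fin n → U) :=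
  (fun b => ⇑f ∘ b) '' D

/-- The orbit `o(D/A)` of `D` under `Aut(U/A)`. -/
def oSet {n : ℕ} (A : Set U) (D : Set (Fin n → U)) : Set (Set (Fin n → U)) :=
  {C | ∃ f ∈ AutFix L U A, imgSet L U f D = C}

/-- The orbit `o(b/A)` of a tuple `b` under `Aut(U/A)`. -/
def oTuple {n : ℕ} (A : Set U) (b : Fin n → U) : Set (Fin n → U) :=
  {c | ∃ f ∈ AutFix L U A, ⇑f ∘ b = c}

/-- A family of sets shatters `B` if every subset of `B` is the trace of a member. -/
def Shatters {α : Type*} (u : Set (Set α)) (B : Set α) : Prop :=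
  ∀ H ⊆ B, ∃ D ∈ u, D ∩ B = H

/-- A family of sets has finite VC dimension if for some `N` it shatters no `N`-element set. -/
def FiniteVC {α : Type*} (u : Set (Set α)) : Prop :=
  ∃ N : ℕ, ∀ B : Finset α, B.card = N → ¬Shatters u ↑B

/-- `B^{|z|}`, the set of tuples with coordinates in `B`. -/
def tuplesIn {n : ℕ} (B : Set U) : Set (Fin n → U) :=
  {a | ∀ i, a i ∈ B}

/-- `φ(b, U)`, the set defined by `φ(x,z)` with `x ↦ b`. -/
def phiSet {m n : ℕ} (φ : L.Formula (Fin m ⊕ Fin n)) (b : Fin m → U) :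
    Set (Fin n → U) :=
  {a | φ.Realize (Sum.elim b a)}

/-- `D` is approximable by `φ(x,z)` : every finite trace of `D` is the trace of
some instance `φ(b,U)`. -/
def ApproxBy {n : ℕ} (D : Set (Fin n → U)) {m : ℕ} (φ : L.Formula (Fin m ⊕ Fin n)) : Prop :=
  ∀ B : Finset U, ∃ b : Fin m → U,
    phiSet L U φ b ∩ tuplesIn U ↑B = D ∩ tuplesIn U ↑B

/-- `D` is approximable from below by `φ(x,z)`. -/
def ApproxBelowBy {n : ℕ} (D : Set (Fin n → U)) {m : ℕ}
    (φ : L.Formula (Fin m ⊕ Fin n)) : Prop :=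
  ∀ B : Finset U, ∃ b : Fin m → U,
    phiSet L U φ b ∩ tuplesIn U ↑B = D ∩ tuplesIn U ↑B ∧ phiSet L U φ b ⊆ D

/-- `D` is approximable from above by `φ(x,z)`. -/
def ApproxAboveBy {n : ℕ} (D : Set (Fin n → U)) {m : ℕ}
    (φ : L.Formula (Fin m ⊕ Fin n)) : Prop :=
  ∀ B : Finset U, ∃ b : Fin m → U,
    phiSet L U φ b ∩ tuplesIn U ↑B = D ∩ tuplesIn U ↑B ∧ D ⊆ phiSet L U φ b

def Approximable {n : ℕ} (D : Set (Fin n → U)) : Prop :=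
  ∃ (m : ℕ) (φ : L.Formula (Fin m ⊕ Fin n)), ApproxBy L U D φ

def ApproxBelow {n : ℕ} (D : Set (Fin n → U)) : Prop :=
  ∃ (m : ℕ) (φ : L.Formula (Fin m ⊕ Fin n)), ApproxBelowBy L U D φ

def ApproxAbove {n : ℕ} (D : Set (Fin n → U)) : Prop :=
  ∃ (m : ℕ) (φ : L.Formula (Fin m ⊕ Fin n)), ApproxAboveBy L U D φ

/-- The formula `φ(x, a)` (an `L(U)`-formula in the variables `x`), obtained by
substituting the tuple `a` for the variables `z` in `φ(x,z)`. -/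
def instFormula {m n : ℕ} (φ : L.Formula (Fin m ⊕ Fin n)) (a : Fin n → U) :
    (L[[U]]).Formula (Fin m) :=
  ((L.lhomWithConstants U).onFormula φ).subst
    (Sum.elim (fun i => Term.var i) (fun j => (L.con (a j)).term))

/-- A (complete) global type in the variables `x = (x_0, ..., x_{m-1})` : a maximal
finitely realized set of `L(U)`-formulas. -/
def IsGlobalType {m : ℕ} (p : Set ((L[[U]]).Formula (Fin m))) : Prop :=
  (∀ s : Finset ((L[[U]]).Formula (Fin m)), ↑s ⊆ p →
    ∃ b : Fin m → U, ∀ φ ∈ s, FRealize U (addAllConsts U iS) φ b) ∧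
  ∀ φ : (L[[U]]).Formula (Fin m), φ ∈ p ↔ φ.not ∉ p

/-- `D` is externally definable: `D = {a : φ(x,a) ∈ p}` for some global type `p` and
formula `φ(x,z)`. -/
def ExtDefinable {n : ℕ} (D : Set (Fin n → U)) : Prop :=
  ∃ (m : ℕ) (φ : L.Formula (Fin m ⊕ Fin n)) (p : Set ((L[[U]]).Formula (Fin m))),
    IsGlobalType L U p ∧ D = {a | instFormula L U φ a ∈ p}

/-- A sequence of `n`-tuples is indiscernible with respect to the formulas of a
structure `S` on `U`. -/
def IndiscIn {L' : FirstOrder.Language.{u, u}} (S : L'.Structure U) {n : ℕ} {I : Type*} [LinearOrder I]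
    (a : I → Fin n → U) : Prop :=
  ∀ (k : ℕ) (i j : Fin k → I), StrictMono i → StrictMono j →
    ∀ φ : L'.Formula (Fin k × Fin n),
      FRealize U S φ (fun q => a (i q.1) q.2) ↔ FRealize U S φ (fun q => a (j q.1) q.2)

/-- An `A`-indiscernible sequence of `n`-tuples. -/
def IndiscOver {n : ℕ} (A : Set U) {I : Type*} [LinearOrder I] (a : I → Fin n → U) : Prop :=
  IndiscIn U (addConsts U iS A) a


/-- `D` is Lascar invariant over `A` : `D` is invariant over every small model containing `A`. -/
def LascarInv {n : ℕ} (A : Set U) (D : Set (Fin n → U)) : Prop :=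
  ∀ M : L.ElementarySubstructure U, A ⊆ (M : L.Substructure U) →
    #((M : L.Substructure U) : Set U) < #U →
    ∀ f ∈ AutFix L U ((M : L.Substructure U) : Set U), imgSet L U f D = D

/-- The cardinality of the set `L(A)` of formulas with parameters in `A`. -/
def formulaCard (A : Set U) : Cardinal.{u} :=
  #(Σ k : ℕ, (L[[↥A]]).Formula (Fin k))

/-- `u` locally covers `B` (relative to the cardinal `κ`). -/
def LocallyCovers {α : Type u} (κ : Cardinal.{u}) (u : Set (Set α)) (B : Set α) : Prop :=
  ∀ K : Set α, K ⊆ B → #K = κ → ∀ k : ℕ, ∃ D ∈ u, (k : Cardinal.{u}) ≤ #(↥(K ∩ D))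

/-- `φ(x, b)` divides over `A` : for some infinite `K ⊆ o(b/A)` and some `k`,
`{φ(x,c) : c ∈ K}` is `k`-inconsistent. -/
def Divides {m n : ℕ} (φ : L.Formula (Fin m ⊕ Fin n)) (b : Fin n → U) (A : Set U) : Prop :=
  ∃ K : Set (Fin n → U), K ⊆ oTuple L U A b ∧ K.Infinite ∧
    ∃ k : ℕ, ∀ s : Finset (Fin n → U), ↑s ⊆ K → s.card = k →
      ¬∃ x : Fin m → U, ∀ c ∈ s, φ.Realize (Sum.elim x c)

/-- `C` is pseudo-invariant over `A` : `e(C)` locally covers `o(b/A)` for every `b ∈ C`. -/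
def PseudoInv {k : ℕ} (A : Set U) (C : Set (Fin k → U)) : Prop :=
  ∀ b ∈ C, LocallyCovers (#U) (eSet L U (∅ : Set U) C) (oTuple L U A b)

/-- A family `u` of subsets of `U^n` is closed: it is cut out by a set of sentences with a
second-order variable, i.e. sentences of the language expanded by a predicate. -/
def ClosedFam {n : ℕ} (u : Set (Set (Fin n → U))) : Prop :=
  ∃ p : Set ((expLang L n).Sentence),
    u = {D | ∀ φ ∈ p, SentRealize U (expStr L U D) φ}

/-- `κ` is a Ramsey cardinal : every `2`-coloring of the finite subsets of a set of size `κ`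
has a homogeneous set of size `κ`. -/
def IsRamseyCard (κ : Cardinal.{u}) : Prop :=
  ∀ (X : Type u), #X = κ → ∀ c : Finset X → Bool,
    ∃ H : Set X, #H = κ ∧
      ∀ s t : Finset X, ↑s ⊆ H → ↑t ⊆ H → s.card = t.card → c s = c t

/-- The formula `φ(x,z)` is NIP: the family of its instances `φ(a,U)` has finite
VC dimension. -/
def FormulaNIP {m n : ℕ} (φ : L.Formula (Fin m ⊕ Fin n)) : Prop :=
  FiniteVC {E : Set (Fin n → U) | ∃ b : Fin m → U, E = phiSet L U φ b}

/-- The theory of `U` is NIP: every formula is NIP. -/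
def TheoryNIP : Prop :=
  ∀ (m n : ℕ) (φ : L.Formula (Fin m ⊕ Fin n)), FormulaNIP L U φ

/-- A global type `p(z)` is invariant over `A` : each of the sets `D_{p,φ}` is fixed
(setwise) by every automorphism fixing `A` pointwise. -/
def GlobalTypeInv {n : ℕ} (A : Set U) (p : Set ((L[[U]]).Formula (Fin n))) : Prop :=
  ∀ (k : ℕ) (φ : L.Formula (Fin n ⊕ Fin k)) (f : U ≃[L] U), f ∈ AutFix L U A →
    imgSet L U f {a | instFormula L U φ a ∈ p} = {a | instFormula L U φ a ∈ p}

/-- `M` (a subset of `U`) is `L(A;C)`-saturated : every finitely realized type `p(x) ⊆ L(A;C)`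
is realized by a tuple from `M`. -/
def LACSat {n : ℕ} (C : Set (Fin n → U)) (A : Set U) (M : Set U) : Prop :=
  ∀ (m : ℕ) (p : Set (((expLang L n)[[↥A]]).Formula (Fin m))),
    (∀ s : Finset (((expLang L n)[[↥A]]).Formula (Fin m)), ↑s ⊆ p →
      ∃ b : Fin m → U, ∀ φ ∈ s, FRealize U (addConsts U (expStr L U C) A) φ b) →
    ∃ b : Fin m → U, (∀ i, b i ∈ M) ∧
      ∀ φ ∈ p, FRealize U (addConsts U (expStr L U C) A) φ b

/-- The inclusion of languages `L(M) → L(U)` for `M : Set U`. -/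
def liftConsts (M : Set U) : (L[[↥M]]) →ᴸ (L[[U]]) :=
  LHom.sumMap (LHom.id L) (LHom.constantsOnMap Subtype.val)


section FormulaTools

variable {L U}

/-- Only finitely many of the variables in `γ` occur in a given formula. -/
theorem exists_formula_fin {γ β : Type*} (χ : L.Formula (γ ⊕ β)) :
    ∃ (m : ℕ) (χ' : L.Formula (Fin m ⊕ β)) (f : Fin m → γ), ∀ (v : γ → U) (w : β → U),
      χ'.Realize (Sum.elim (v ∘ f) w) ↔ χ.Realize (Sum.elim v w) := by
  classical
  let s : Finset γ := χ.freeVarFinset.toLeft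
  let e := s.equivFin
  let g : χ.freeVarFinset → Fin s.card ⊕ β := fun x =>
    Sum.casesOn (motive := fun y => y ∈ χ.freeVarFinset → Fin s.card ⊕ β) x.1
      (fun y hy => Sum.inl (e ⟨y, by simpa [s] using hy⟩)) (fun y _ => Sum.inr y) x.2
  refine ⟨s.card, χ.restrictFreeVar g, fun i => (e.symm i).1, fun v w => ?_⟩
  refine BoundedFormula.realize_restrictFreeVar _ ?_
  rintro ⟨y | y, hy⟩ <;> simp [g]

/-- Projection of a definable relation on possibly infinitely many variables along an injection. -/
theorem exists_formula_projection {α γ : Type*} [Nonempty U] (χ : L.Formula γ) (f : α → γ)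
    (hf : Function.Injective f) :
    ∃ ψ : L.Formula α, ∀ w : α → U, ψ.Realize w ↔ ∃ v : γ → U, v ∘ f = w ∧ χ.Realize v := by
  classical
  let g : χ.freeVarFinset → α ⊕ χ.freeVarFinset := fun c =>
    if h : ∃ a, f a = c then Sum.inl h.choose else Sum.inr c
  refine ⟨Formula.iExs χ.freeVarFinset (χ.restrictFreeVar g), fun w => ?_⟩
  rw [Formula.realize_iExs]
  have key : ∀ (i : χ.freeVarFinset → U) (v : γ → U), v ∘ f = w →
      (∀ c : χ.freeVarFinset, (¬ ∃ a, f a = c) → i c = v c) →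
      (Formula.Realize (χ.restrictFreeVar g) (Sum.elim w i) ↔ χ.Realize v) := by
    intro i v hv hi
    refine BoundedFormula.realize_restrictFreeVar _ fun c => ?_
    by_cases h : ∃ a, f a = c
    · have := h.choose_spec
      simp only [g, dif_pos h, Sum.elim_inl, ← hv, Function.comp_apply, this]
    · simp only [g, dif_neg h, Sum.elim_inr, hi c h]
  constructor
  · rintro ⟨i, hi⟩
    let v : γ → U := fun c => if h : ∃ a, f a = c then w h.choose else
      if h' : c ∈ χ.freeVarFinset then i ⟨c, h'⟩ else Classical.arbitrary U
    have hv : v ∘ f = w := by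
      funext a
      have h : ∃ a', f a' = f a := ⟨a, rfl⟩
      simp only [v, Function.comp_apply, dif_pos h]
      rw [hf h.choose_spec]
    refine ⟨v, hv, (key i v hv ?_).1 hi⟩
    intro c hc
    simp [v, dif_neg hc]
  · rintro ⟨v, hv, h⟩
    exact ⟨fun c => v c, (key _ v hv fun _ _ => rfl).2 h⟩

theorem exists_formula_projection_pair {α γ ι : Type*} [Finite ι] [Nonempty U] (χ : L.Formula γ)
    (g : α → γ) (hg : Function.Injective g) (f : ι → γ) :
    ∃ ψ : L.Formula (α ⊕ ι), ∀ (a : α → U) (w : ι → U), ψ.Realize (Sum.elim a w) ↔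
      ∃ v : γ → U, v ∘ g = a ∧ v ∘ f = w ∧ χ.Realize v := by
  let χ' : L.Formula (γ ⊕ ι) := χ.relabel Sum.inl ⊓
    Formula.iInf fun i => Term.equal (Term.var (Sum.inl (f i))) (Term.var (Sum.inr i))
  obtain ⟨ψ, hψ⟩ := exists_formula_projection (U := U) χ' (Sum.map g id)
    (Sum.map_injective.2 ⟨hg, Function.injective_id⟩)
  refine ⟨ψ, fun a w => (hψ _).trans ⟨?_, ?_⟩⟩
  · rintro ⟨v, hv, h⟩
    simp only [χ', Formula.realize_inf, Formula.realize_relabel, Formula.realize_iInf,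
      Formula.realize_equal, Term.realize_var] at h
    refine ⟨v ∘ Sum.inl, ?_, ?_, h.1⟩
    · funext x; simpa using congrFun hv (Sum.inl x)
    · funext i; simpa [h.2 i] using congrFun hv (Sum.inr i)
  · rintro ⟨v, rfl, rfl, h⟩
    refine ⟨Sum.elim v (v ∘ f), ?_, ?_⟩
    · funext x; rcases x with x | x <;> rfl
    · simpa [χ', Function.comp_def] using h

end FormulaTools

section InnerApprox

variable {U}

/-- `S` is approximated by subsets of `D` taken from a single definable family (in which
infinitely many parameters are allowed). -/
def InnerApprox {n : ℕ} (D S : Set (Fin n → U)) : Prop :=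
  ∃ (γ : Type u) (θ : L.Formula (γ ⊕ Fin n)), ∀ B : Finset (Fin n → U), ↑B ⊆ S →
    ∃ d : γ → U, (∀ z ∈ B, θ.Realize (Sum.elim d z)) ∧ ∀ z, θ.Realize (Sum.elim d z) → z ∈ D

variable {L} {n : ℕ} {D : Set (Fin n → U)}

theorem InnerApprox.mono {S S' : Set (Fin n → U)} (h : InnerApprox L D S') (hS : S ⊆ S') :
    InnerApprox L D S := by
  obtain ⟨γ, θ, h⟩ := h
  exact ⟨γ, θ, fun B hB => h B (hB.trans hS)⟩

theorem InnerApprox.empty [Nonempty U] : InnerApprox L D ∅ := by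
  refine ⟨PUnit, ⊥, fun B hB => ⟨fun _ => Classical.arbitrary U, fun z hz => (hB hz).elim, ?_⟩⟩
  intro z hz
  simp at hz

theorem InnerApprox.union {S S' : Set (Fin n → U)} (h : InnerApprox L D S)
    (h' : InnerApprox L D S') : InnerApprox L D (S ∪ S') := by
  classical
  obtain ⟨γ, θ, h⟩ := h
  obtain ⟨γ', θ', h'⟩ := h'
  refine ⟨γ ⊕ γ', θ.relabel (Sum.map Sum.inl id) ⊔ θ'.relabel (Sum.map Sum.inr id), fun B hB => ?_⟩
  obtain ⟨d, hd, hd'⟩ := h (B.filter (· ∈ S)) (fun z hz => (Finset.mem_filter.1 hz).2)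
  obtain ⟨e, he, he'⟩ := h' (B.filter (· ∈ S')) (fun z hz => (Finset.mem_filter.1 hz).2)
  have hr : ∀ z, (θ.relabel (Sum.map Sum.inl id) ⊔ θ'.relabel (Sum.map Sum.inr id) :
      L.Formula ((γ ⊕ γ') ⊕ Fin n)).Realize (Sum.elim (Sum.elim d e) z) ↔
      θ.Realize (Sum.elim d z) ∨ θ'.Realize (Sum.elim e z) := by
    intro z
    rw [Formula.realize_sup, Formula.realize_relabel, Formula.realize_relabel,
      Sum.elim_comp_map, Sum.elim_comp_map]
    rfl
  refine ⟨Sum.elim d e, fun z hz => (hr z).2 ?_, fun z hz => ?_⟩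
  · rcases hB hz with hzS | hzS
    · exact Or.inl (hd z (Finset.mem_filter.2 ⟨hz, hzS⟩))
    · exact Or.inr (he z (Finset.mem_filter.2 ⟨hz, hzS⟩))
  · exact ((hr z).1 hz).elim (hd' z) (he' z)

theorem InnerApprox.approxBelow (h : InnerApprox L D D) : ApproxBelow L U D := by
  obtain ⟨γ, θ, h⟩ := h
  obtain ⟨m, θ', f, hf⟩ := exists_formula_fin (U := U) θ
  refine ⟨m, θ', fun B => ?_⟩
  have hfin : (D ∩ tuplesIn U (n := n) ↑B).Finite := by
    refine Set.Finite.subset (Set.Finite.pi' (fun _ : Fin n => B.finite_toSet)) ?_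
    exact fun z hz i => hz.2 i
  obtain ⟨d, hd, hd'⟩ := h hfin.toFinset (by simp)
  refine ⟨d ∘ f, ?_, fun z hz => hd' z ((hf d z).1 hz)⟩
  ext z
  refine ⟨fun hz => ⟨hd' z ((hf d z).1 hz.1), hz.2⟩, fun hz => ⟨(hf d z).2 (hd z ?_), hz.2⟩⟩
  exact hfin.mem_toFinset.2 hz

/-- If `D` is not approximable from below, some ultrafilter containing `D` contains no
`InnerApprox` set. -/
theorem exists_ultrafilter_not_innerApprox [Nonempty U] (h : ¬ InnerApprox L D D) :
    ∃ q : Ultrafilter (Fin n → U), D ∈ q ∧ ∀ S ∈ q, ¬ InnerApprox L D S := by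
  let F : Filter (Fin n → U) :=
    { sets := {S | InnerApprox L D (D \ S)}
      univ_sets := by simpa using InnerApprox.empty
      sets_of_superset := fun {S T} hS hST => InnerApprox.mono hS (Set.sdiff_subset_sdiff_right hST)
      inter_sets := fun {S T} hS hT => by
        simpa [Set.sdiff_inter] using InnerApprox.union hS hT }
  have hF : ∀ S, S ∈ F ↔ InnerApprox L D (D \ S) := fun _ => Iff.rfl
  have : F.NeBot := ⟨fun hb => h (by simpa [hb] using hF ∅)⟩
  refine ⟨Ultrafilter.of F, Ultrafilter.of_le F ((hF _).2 ?_), fun S hS hS' => ?_⟩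
  · simpa using InnerApprox.empty
  · have : Sᶜ ∈ Ultrafilter.of F :=
      Ultrafilter.of_le F ((hF _).2 (hS'.mono (by simp)))
    exact Ultrafilter.compl_mem_iff_notMem.1 this hS

/-- The iterated power of an ultrafilter. -/
def ultraPow {Z : Type*} (q : Ultrafilter Z) : (N : ℕ) → Ultrafilter (Fin N → Z)
  | 0 => pure default
  | N + 1 => q.bind fun z => (ultraPow q N).map (Fin.cons z)

theorem mem_ultraPow_succ {Z : Type*} {q : Ultrafilter Z} {N : ℕ} {R : Set (Fin (N + 1) → Z)} :
    R ∈ ultraPow q (N + 1) ↔ ∀ᶠ z in q, {d | (Fin.cons z d : Fin (N + 1) → Z) ∈ R} ∈ ultraPow q N :=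
  Filter.mem_bind'

/-- A relation between `n`-tuples definable with parameters. -/
def ParamDef (L : FirstOrder.Language.{u, u}) [L.Structure U] {N : ℕ}
    (R : Set (Fin N → Fin n → U)) : Prop :=
  ∃ χ : L.Formula (U ⊕ Fin N × Fin n), ∀ d, d ∈ R ↔ χ.Realize (Sum.elim id fun p => d p.1 p.2)

/-- Sets that are large for the iterated power of an ultrafilter avoiding the `InnerApprox` sets
meet every pattern with respect to `D`. -/
theorem exists_pattern {q : Ultrafilter (Fin n → U)} (hD : D ∈ q)
    (hq : ∀ S ∈ q, ¬ InnerApprox L D S) :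
    ∀ {N : ℕ} (σ : Fin N → Prop) (R : Set (Fin N → Fin n → U)), ParamDef L R →
      R ∈ ultraPow q N → ∃ d ∈ R, ∀ i, d i ∈ D ↔ σ i
  | 0, σ, R, _, hR => ⟨default, hR, fun i => i.elim0⟩
  | N + 1, σ, R, ⟨χ, hχ⟩, hR => by
    rw [mem_ultraPow_succ] at hR
    let ρ (z : Fin n → U) : U ⊕ Fin (N + 1) × Fin n → U ⊕ Fin N × Fin n :=
      Sum.elim Sum.inl fun p => (Fin.cons (fun j => Sum.inl (z j)) (fun i j => Sum.inr (i, j)) :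
        Fin (N + 1) → Fin n → U ⊕ Fin N × Fin n) p.1 p.2
    have hρ : ∀ z (d : Fin N → Fin n → U), (χ.relabel (ρ z)).Realize
        (Sum.elim id fun p => d p.1 p.2) ↔ (Fin.cons z d : Fin (N + 1) → Fin n → U) ∈ R := by
      intro z d
      rw [hχ, Formula.realize_relabel]
      refine iff_of_eq (congrArg _ (funext ?_))
      rintro (x | ⟨i, j⟩)
      · rfl
      · refine Fin.cases ?_ (fun i => ?_) i <;> rfl
    by_cases hσ : σ 0
    · obtain ⟨z, hz, hzD⟩ := (hR.and hD).exists
      obtain ⟨d, hd, hdσ⟩ := exists_pattern hD hq (fun i => σ i.succ) _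
        ⟨χ.relabel (ρ z), fun d => (hρ z d).symm⟩ hz
      refine ⟨Fin.cons z d, hd, Fin.cases ?_ fun i => ?_⟩
      · exact iff_of_true hzD hσ
      · simpa using hdσ i
    · have hS := hq _ hR
      let τ : U ⊕ Fin (N + 1) × Fin n → (U ⊕ Fin N × Fin n) ⊕ Fin n :=
        Sum.elim (Sum.inl ∘ Sum.inl) fun p =>
          (Fin.cons (fun j => Sum.inr j) (fun i j => Sum.inl (Sum.inr (i, j))) :
            Fin (N + 1) → Fin n → (U ⊕ Fin N × Fin n) ⊕ Fin n) p.1 p.2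
      have hτ : ∀ z (d : Fin N → Fin n → U), (χ.relabel τ).Realize
          (Sum.elim (Sum.elim id fun p => d p.1 p.2) z) ↔
            (Fin.cons z d : Fin (N + 1) → Fin n → U) ∈ R := by
        intro z d
        rw [hχ, Formula.realize_relabel]
        refine iff_of_eq (congrArg _ (funext ?_))
        rintro (x | ⟨i, j⟩)
        · rfl
        · refine Fin.cases ?_ (fun i => ?_) i <;> rfl
      simp only [InnerApprox, not_exists, not_forall] at hS
      obtain ⟨B, hB, hBd⟩ := hS _ (χ.relabel τ)
      have hRB : (⋂ z ∈ B, {d | (Fin.cons z d : Fin (N + 1) → Fin n → U) ∈ R}) ∈ ultraPow q N :=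
        (Filter.biInter_finset_mem B).2 fun z hz => hB hz
      obtain ⟨d, hd, hdσ⟩ := exists_pattern hD hq (fun i => σ i.succ) _
        ⟨Formula.iInf fun z : B => χ.relabel (ρ z), fun d => by
          simp only [Set.mem_iInter, Formula.realize_iInf, hρ, Subtype.forall]; rfl⟩ hRB
      simp only [Set.mem_iInter] at hd
      have := hBd (Sum.elim id fun p => d p.1 p.2)
      simp only [hτ, not_and, not_forall] at this
      obtain ⟨e, he, heD⟩ := this hd
      refine ⟨Fin.cons e d, he, Fin.cases ?_ fun i => ?_⟩
      · simpa [hσ] using heD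
      · simpa using hdσ i

end InnerApprox

section Parameters

variable {U} {L' : FirstOrder.Language.{u, u}}

theorem frealize_addConsts (S : L'.Structure U) (A : Set U) {β : Type*}
    (φ : (L'[[↥A]]).Formula β) (v : β → U) :
    FRealize U (addConsts U S A) φ v ↔
      FRealize U S (BoundedFormula.constantsVarsEquiv φ) (Sum.elim Subtype.val v) := by
  let := S
  let : (constantsOn ↥A).Structure U := constantsOn.structure Subtype.val
  have : (L'.lhomWithConstants ↥A).IsExpansionOn U := ⟨fun _ _ => rfl, fun _ _ => rfl⟩
  exact (BoundedFormula.realize_constantsVarsEquiv (φ := φ) (v := v) (xs := default)).symm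

theorem eqvOver_iff [L'.Structure U] {n : ℕ} {A : Set U} {C D : Set (Fin n → U)} :
    EqvOver L' U A C D ↔ ∀ φ : (expLang L' n).Formula (A ⊕ Empty),
      FRealize U (expStr L' U C) φ (Sum.elim Subtype.val default) ↔
        FRealize U (expStr L' U D) φ (Sum.elim Subtype.val default) := by
  refine ⟨fun h φ => ?_, fun h φ => ?_⟩
  · have := h (BoundedFormula.constantsVarsEquiv.symm φ)
    rwa [SentRealize, SentRealize, Sentence.Realize, Sentence.Realize, ← FRealize, ← FRealize,
      frealize_addConsts, frealize_addConsts, Equiv.apply_symm_apply] at this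
  · rw [SentRealize, SentRealize, Sentence.Realize, Sentence.Realize, ← FRealize, ← FRealize,
      frealize_addConsts, frealize_addConsts]
    exact h _

theorem IsSatStr.exists_realize [S : L'.Structure U] (hS : IsSatStr U S) {A : Set U}
    (hA : #A < #U) {ι : Type*} [Finite ι] (p : Set (L'.Formula (A ⊕ ι)))
    (hp : ∀ s : Finset (L'.Formula (A ⊕ ι)), ↑s ⊆ p →
      ∃ b : ι → U, ∀ φ ∈ s, φ.Realize (Sum.elim Subtype.val b)) :
    ∃ b : ι → U, ∀ φ ∈ p, φ.Realize (Sum.elim Subtype.val b) := by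
  classical
  obtain ⟨m, ⟨e⟩⟩ := Finite.exists_equiv_fin ι
  let T : L'.Formula (A ⊕ ι) → (L'[[↥A]]).Formula (Fin m) := fun χ =>
    BoundedFormula.constantsVarsEquiv.symm (χ.relabel (Sum.map id e) : L'.Formula (A ⊕ Fin m))
  have hT : ∀ χ (b : Fin m → U), FRealize U (addConsts U S A) (T χ) b ↔
      χ.Realize (Sum.elim Subtype.val (b ∘ e)) := by
    intro χ b
    rw [frealize_addConsts, Equiv.apply_symm_apply, FRealize, Formula.realize_relabel,
      Sum.elim_comp_map, Function.comp_id]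
  obtain ⟨b, hb⟩ := hS A hA m (T '' p) fun s hs => by
    obtain ⟨s', hs', rfl⟩ := Finset.subset_set_image_iff.1 hs
    obtain ⟨b, hb⟩ := hp s' hs'
    refine ⟨b ∘ e.symm, fun φ hφ => ?_⟩
    obtain ⟨χ, hχ, rfl⟩ := Finset.mem_image.1 hφ
    rw [hT]
    simpa [Function.comp_assoc] using hb χ hχ
  exact ⟨b ∘ e, fun φ hφ => (hT φ b).1 (hb _ ⟨φ, hφ, rfl⟩)⟩

end Parameters

section LimitChoice

theorem exists_limit_choice {J V X : Type*} [LinearOrder J] [WellFoundedLT J] [Inhabited X]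
    {F₀ : Filter V} [F₀.NeBot] (s : J → X → Set V)
    (step : ∀ (j : J) (c : J → X), (F₀ ⊓ ⨅ i : Iio j, Filter.principal (s i (c i))).NeBot →
      ∃ o, (F₀ ⊓ (⨅ i : Iio j, Filter.principal (s i (c i))) ⊓ Filter.principal (s j o)).NeBot) :
    ∃ c : J → X, (F₀ ⊓ ⨅ i, Filter.principal (s i (c i))).NeBot := by
  classical
  have hdir : ∀ (c : J → X) (I : Set J), (∀ j ∈ I,
      (F₀ ⊓ ⨅ i : Iic j, Filter.principal (s i (c i))).NeBot) →
      (F₀ ⊓ ⨅ i : I, Filter.principal (s i (c i))).NeBot := by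
    intro c I hI
    rcases I.eq_empty_or_nonempty with rfl | hne
    · simpa [iInf_of_empty]
    · have : Nonempty I := hne.to_subtype
      have hd : Directed (· ≥ ·) fun j : I =>
          F₀ ⊓ ⨅ i : Iic (j : J), Filter.principal (s i (c i)) := by
        refine directed_of_isDirected_le fun j k hjk => inf_le_inf_left _ ?_
        refine le_iInf fun i => iInf_le_of_le ⟨i.1, i.2.trans hjk⟩ le_rfl
      have := Filter.iInf_neBot_of_directed' hd fun j => hI j j.2
      refine this.mono ?_
      rw [← inf_iInf]
      refine inf_le_inf_left _ (le_iInf fun j => iInf_le_of_le j (iInf_le_of_le ⟨j.1, le_rfl⟩ le_rfl))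
  let P : (j : J) → ((i : J) → i < j → X) → X → Prop := fun j g o =>
    (F₀ ⊓ (⨅ i : Iio j, Filter.principal (s i (g i i.2))) ⊓ Filter.principal (s j o)).NeBot
  let c : J → X := (wellFounded_lt (α := J)).fix fun j g =>
    if h : ∃ o, P j g o then h.choose else default
  have hc : ∀ j, (∃ o, P j (fun i _ => c i) o) → P j (fun i _ => c i) (c j) := by
    intro j h
    have : c j = h.choose := by
      change WellFounded.fix _ _ j = _
      rw [WellFounded.fix_eq]
      exact dif_pos h
    rw [this]
    exact h.choose_spec
  have main : ∀ j, (F₀ ⊓ ⨅ i : Iic j, Filter.principal (s i.1 (c i.1))).NeBot := by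
    intro j
    induction j using (wellFounded_lt (α := J)).induction with
    | _ j ih =>
    have h := hc j (step j c (hdir c (Iio j) fun i hi => ih i hi))
    refine Filter.NeBot.mono h ?_
    rw [inf_assoc]
    refine inf_le_inf_left _ (le_iInf fun i => ?_)
    rcases (Set.mem_Iic.1 i.2).lt_or_eq with hi | hi
    · exact inf_le_left.trans (iInf_le_of_le ⟨i.1, hi⟩ le_rfl)
    · exact inf_le_right.trans (by rw [hi])
  refine ⟨c, ?_⟩
  have := hdir c univ fun j _ => main j
  exact this.mono (inf_le_inf_left _ (le_iInf fun j => iInf_le_of_le ⟨j, trivial⟩ le_rfl))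

end LimitChoice

section DiagFilter

variable {U}

/-- The filter of all maps `U → U` that is generated by the complete type of `U` over `∅`,
enumerated by the identity. -/
def diagFilter (L : FirstOrder.Language.{u, u}) [L.Structure U] : Filter (U → U) where
  sets := {S | ∃ χ : L.Formula U, χ.Realize id ∧ ∀ v, χ.Realize v → v ∈ S}
  univ_sets := ⟨⊤, Formula.realize_top.2 trivial, fun _ _ => trivial⟩
  sets_of_superset := fun ⟨χ, h, h'⟩ hST => ⟨χ, h, fun v hv => hST (h' v hv)⟩
  inter_sets := fun ⟨χ, h, h'⟩ ⟨ψ, k, k'⟩ =>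
    ⟨χ ⊓ ψ, Formula.realize_inf.2 ⟨h, k⟩, fun v hv =>
      ⟨h' v (Formula.realize_inf.1 hv).1, k' v (Formula.realize_inf.1 hv).2⟩⟩

variable {L}

theorem mem_diagFilter {S : Set (U → U)} :
    S ∈ diagFilter L ↔ ∃ χ : L.Formula U, χ.Realize id ∧ ∀ v, χ.Realize v → v ∈ S :=
  Iff.rfl

theorem eventually_diagFilter {χ : L.Formula U} (h : χ.Realize id) :
    ∀ᶠ v in diagFilter L, χ.Realize v :=
  ⟨χ, h, fun _ hv => hv⟩

theorem eventually_diagFilter_iff (χ : L.Formula U) :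
    ∀ᶠ v in diagFilter L, (χ.Realize v ↔ χ.Realize id) := by
  by_cases h : χ.Realize id
  · exact (eventually_diagFilter h).mono fun v hv => iff_of_true hv h
  · exact (eventually_diagFilter (χ := ∼χ) h).mono fun v hv => iff_of_false hv h

/-- A condition on `v : U → U` depending on few values of `v` is consistent with being witnessed
by the value of `v` at a single point, or with having no witness. -/
theorem exists_witness [Nonempty U] (hsat : IsSatStr U iS) {A : Set U} (hA : #A < #U)
    (G : Filter (A → U)) (Φ : U → (A → U) → Prop)
    (hF : (diagFilter L ⊓ Filter.comap (· ∘ Subtype.val) G).NeBot) :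
    (diagFilter L ⊓ Filter.comap (· ∘ Subtype.val) G ⊓
      Filter.principal {v | ∀ x, ¬ Φ x (v ∘ Subtype.val)}).NeBot ∨
    ∃ u, (diagFilter L ⊓ Filter.comap (· ∘ Subtype.val) G ⊓
      Filter.principal {v | Φ (v u) (v ∘ Subtype.val)}).NeBot := by
  set F := diagFilter L ⊓ Filter.comap (· ∘ Subtype.val) G with hFdef
  by_contra! hcon
  obtain ⟨h₁, h₂⟩ := hcon
  simp only [Filter.inf_principal_eq_bot] at h₁ h₂
  have h₁' : ∀ᶠ v in F, ∃ x, Φ x (v ∘ Subtype.val) := by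
    filter_upwards [h₁] with v hv
    simpa using hv
  let p : Set (L.Formula (A ⊕ Fin 1)) :=
    {ψ | ∀ᶠ v in F, ∀ x, Φ x (v ∘ Subtype.val) → ψ.Realize (Sum.elim (v ∘ Subtype.val) fun _ => x)}
  obtain ⟨b, hb⟩ := hsat.exists_realize hA p fun s hs => by
    by_contra! hno
    let χ : L.Formula U := Formula.relabel (Subtype.val : A → U)
      (Formula.iExs (Fin 1) (Formula.iInf fun ψ : s => (ψ : L.Formula (A ⊕ Fin 1))))
    have hχ : ∀ v : U → U, χ.Realize v ↔
        ∃ b : Fin 1 → U, ∀ ψ ∈ s, ψ.Realize (Sum.elim (v ∘ Subtype.val) b) := by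
      intro v
      simp [χ, Formula.realize_relabel, Formula.realize_iExs, Formula.realize_iInf]
    have hχ' : ∀ᶠ v in F, ¬ χ.Realize v := by
      refine (eventually_diagFilter (χ := ∼χ) ?_).filter_mono inf_le_left
      rw [Formula.realize_not, hχ]
      push Not
      exact hno
    have hs' : ∀ᶠ v in F, ∀ ψ ∈ s, ∀ x, Φ x (v ∘ Subtype.val) →
        ψ.Realize (Sum.elim (v ∘ Subtype.val) fun _ => x) :=
      (Filter.eventually_all_finset s).2 fun ψ hψ => hs hψ
    obtain ⟨v, hv, hv', x, hx⟩ := (hχ'.and (hs'.and h₁')).exists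
    exact hv ((hχ v).2 ⟨fun _ => x, fun ψ hψ => hv' ψ hψ x hx⟩)
  obtain ⟨S, hS, T, ⟨t, ht, htT⟩, hST⟩ := Filter.mem_inf_iff_superset.1 (h₂ (b 0))
  obtain ⟨χ, hχ, hχS⟩ := mem_diagFilter.1 hS
  obtain ⟨ψ, hψ⟩ := exists_formula_projection_pair (U := U) χ (Subtype.val : A → U)
    Subtype.val_injective (fun _ : Fin 1 => b 0)
  have hmem : ∼ψ ∈ p := by
    have : ∀ᶠ v : U → U in F, v ∘ Subtype.val ∈ t :=
      Filter.Eventually.filter_mono inf_le_right (Filter.preimage_mem_comap ht)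
    filter_upwards [this] with v hv x hx
    rw [Formula.realize_not, hψ]
    rintro ⟨w, hw, hwx, hwχ⟩
    have hwt : w ∈ T := htT (by simpa [hw] using hv)
    refine hST ⟨hχS w hwχ, hwt⟩ ?_
    have h0 : w (b 0) = x := congrFun hwx 0
    simpa [hw, h0] using hx
  refine hb _ hmem ((hψ _ _).2 ⟨id, rfl, ?_, hχ⟩)
  funext i
  simp [Subsingleton.elim i 0]

end DiagFilter

section DecidedFilter

variable {U}

theorem exists_comap_eq_principal {A B : Set U} (hAB : A ⊆ B) {S : Set (U → U)}
    (hS : DependsOn (· ∈ S) A) :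
    ∃ G : Filter (B → U), Filter.principal S = Filter.comap (· ∘ Subtype.val) G := by
  refine ⟨Filter.principal ((· ∘ Subtype.val) '' S), ?_⟩
  rw [Filter.comap_principal]
  congr 1
  refine (Set.subset_preimage_image _ S).antisymm ?_
  rintro v ⟨w, hw, hwv⟩
  exact (hS (x := w) (y := v) fun a ha => congrFun hwv ⟨a, hAB ha⟩).mp hw

variable {L}

theorem exists_decided_filter [Nonempty U] (hsat : IsSatStr U iS) (hU : (#U).IsRegular)
    {A₀ : Set U} (hA₀ : #A₀ < #U) {S₀ : Set (U → U)} (hS₀ : DependsOn (· ∈ S₀) A₀)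
    (hne : (diagFilter L ⊓ Filter.principal S₀).NeBot) {T : Type u} [Nonempty T] (hT : #T ≤ #U)
    (A : T → Set U) (hA : ∀ t, #(A t) < #U) (Φ : T → U → (U → U) → Prop)
    (hΦ : ∀ t x, DependsOn (Φ t x) (A t)) :
    ∃ F : Filter (U → U), F.NeBot ∧ F ≤ diagFilter L ∧ S₀ ∈ F ∧
      ∀ t, (∀ᶠ v in F, ∀ x, ¬ Φ t x v) ∨ ∃ u, ∀ᶠ v in F, Φ t (v u) v := by
  let J := (#U).ord.ToType
  obtain ⟨e⟩ : Nonempty (T ↪ J) := by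
    rwa [← Cardinal.le_def, Cardinal.mk_ord_toType]
  let τ : J → T := Function.invFun e
  have hτ : Function.Surjective τ := Function.invFun_surjective e.injective
  let s : J → Option U → Set (U → U) := fun j o =>
    o.elim {v | ∀ x, ¬ Φ (τ j) x v} fun u => {v | Φ (τ j) (v u) v}
  let K : J → Option U → Set U := fun j o => A (τ j) ∪ {u | o = some u}
  have hsK : ∀ j o, DependsOn (· ∈ s j o) (K j o) := by
    rintro j (_ | u) v w hvw
    · exact propext (forall_congr' fun x => not_congr (iff_of_eq
        (hΦ _ x fun a ha => hvw a (Or.inl ha))))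
    · have : v u = w u := hvw u (Or.inr rfl)
      change Φ (τ j) (v u) v = Φ (τ j) (w u) w
      rw [this]
      exact hΦ _ _ fun a ha => hvw a (Or.inl ha)
  have hK : ∀ j o, #(K j o) < #U := by
    intro j o
    refine (Cardinal.mk_union_le _ _).trans_lt (Cardinal.add_lt_of_lt hU.aleph0_le (hA _) ?_)
    refine lt_of_le_of_lt ?_ (Cardinal.one_lt_aleph0.trans_le hU.aleph0_le)
    refine Cardinal.mk_le_one_iff_set_subsingleton.2 fun a ha b hb => ?_
    exact Option.some_injective _ (ha.symm.trans hb)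
  have step : ∀ (j : J) (c : J → Option U),
      (diagFilter L ⊓ Filter.principal S₀ ⊓ ⨅ i : Iio j, Filter.principal (s i (c i))).NeBot →
      ∃ o, (diagFilter L ⊓ Filter.principal S₀ ⊓ (⨅ i : Iio j, Filter.principal (s i (c i))) ⊓
        Filter.principal (s j o)).NeBot := by
    intro j c hj
    let B : Set U := A₀ ∪ (A (τ j) ∪ ⋃ i : Iio j, K i (c i))
    have hB : #B < #U := by
      refine (Cardinal.mk_union_le _ _).trans_lt (Cardinal.add_lt_of_lt hU.aleph0_le hA₀ ?_)
      refine (Cardinal.mk_union_le _ _).trans_lt (Cardinal.add_lt_of_lt hU.aleph0_le (hA _) ?_)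
      exact (Cardinal.card_iUnion_lt_iff_forall_of_isRegular hU
        ((Cardinal.mk_Iio_lt j (by simp [J])).trans_eq (Cardinal.mk_ord_toType _))).2 fun i => hK _ _
    have hAB : A (τ j) ⊆ B := Set.subset_union_left.trans Set.subset_union_right
    obtain ⟨G₀, hG₀⟩ := exists_comap_eq_principal (B := B) Set.subset_union_left hS₀
    have hG : ∀ i : Iio j, ∃ G : Filter (B → U),
        Filter.principal (s i (c i)) = Filter.comap (· ∘ Subtype.val) G := fun i =>
      exists_comap_eq_principal (((Set.subset_iUnion (fun i : Iio j => K i (c i)) i).trans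
        Set.subset_union_right).trans Set.subset_union_right) (hsK i (c i))
    choose G hG using hG
    let Ψ : U → (B → U) → Prop := fun x w => ∃ v, v ∘ Subtype.val = w ∧ Φ (τ j) x v
    have hΨ : ∀ x v, Ψ x (v ∘ Subtype.val) ↔ Φ (τ j) x v := by
      refine fun x v => ⟨fun ⟨w, hw, h⟩ => ?_, fun h => ⟨v, rfl, h⟩⟩
      exact (hΦ _ x fun a ha => congrFun hw ⟨a, hAB ha⟩).mp h
    have hF : diagFilter L ⊓ Filter.principal S₀ ⊓ (⨅ i : Iio j, Filter.principal (s i (c i))) =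
        diagFilter L ⊓ Filter.comap (· ∘ Subtype.val) (G₀ ⊓ ⨅ i, G i) := by
      simp only [hG, hG₀, inf_assoc, Filter.comap_inf, Filter.comap_iInf]
    rw [hF] at hj ⊢
    rcases exists_witness hsat hB _ Ψ hj with h | ⟨u, h⟩
    · simp only [hΨ] at h
      exact ⟨none, h⟩
    · simp only [hΨ] at h
      exact ⟨some u, h⟩
  obtain ⟨c, hc⟩ := exists_limit_choice s step
  refine ⟨_, hc, inf_le_left.trans inf_le_left,
    (inf_le_left.trans inf_le_right : _ ≤ Filter.principal S₀) (Filter.mem_principal_self _),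
    fun t => ?_⟩
  obtain ⟨j, rfl⟩ := hτ t
  have hj : s j (c j) ∈ diagFilter L ⊓ Filter.principal S₀ ⊓
      ⨅ i, Filter.principal (s i (c i)) :=
    Filter.mem_inf_of_right (Filter.mem_iInf_of_mem j (Filter.mem_principal_self _))
  rcases hcj : c j with _ | u
  · rw [hcj] at hj
    exact Or.inl hj
  · rw [hcj] at hj
    exact Or.inr ⟨u, hj⟩

end DecidedFilter

section Resplendence

variable {U}

/-- A copy of `U` carrying the structure of the expansion `⟨U, D⟩`. -/
def Expansion {n : ℕ} (_ : Set (Fin n → U)) : Type u := U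

instance {n : ℕ} (D : Set (Fin n → U)) : (expLang L n).Structure (Expansion D) := expStr L U D

instance {n : ℕ} (D : Set (Fin n → U)) [h : Nonempty U] : Nonempty (Expansion D) := h

variable {L} {n : ℕ} {D : Set (Fin n → U)}

/-- The set on `U` induced along the diagonal map by an ultrapower of `⟨U, D⟩`. -/
def limitSet (W : Ultrafilter (U → U)) (D : Set (Fin n → U)) : Set (Fin n → U) :=
  {a | ∀ᶠ v in W, v ∘ a ∈ D}

/-- The class in the ultrapower of `⟨U, D⟩` of a family indexed by the maps `U → U`. -/
def limitClass (W : Ultrafilter (U → U)) (D : Set (Fin n → U)) (a : (U → U) → U) :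
    (W : Filter (U → U)).Product fun _ => Expansion D :=
  @Quotient.mk' _ ((W : Filter (U → U)).productSetoid fun _ => Expansion D) a

/-- The map sending `u` to the class of the evaluation at `u`. -/
def limitEmbedding [Nonempty U] {W : Ultrafilter (U → U)} (hW : (W : Filter (U → U)) ≤ diagFilter L)
    (D : Set (Fin n → U)) :
    Expansion (limitSet W D) ↪[expLang L n]
      (W : Filter (U → U)).Product fun _ => Expansion D where
  toFun u := limitClass W D fun v => v u
  inj' u u' h := by
    have h' : ∀ᶠ v : U → U in W, v u = v u' := Quotient.eq''.1 h
    by_contra hne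
    let χ : L.Formula U := ∼(Term.equal (Term.var u) (Term.var u'))
    have : ∀ᶠ v : U → U in W, χ.Realize v :=
      (eventually_diagFilter (χ := χ) hne).filter_mono hW
    obtain ⟨v, hv, hv'⟩ := (h'.and this).exists
    simp only [χ, Formula.realize_not, Formula.realize_equal] at hv'
    exact hv' hv
  map_fun' {k} f x := by
    rcases f with f | f
    · refine Eq.trans (Quotient.eq''.2 ?_) (Ultraproduct.funMap_cast (L := expLang L n)
        (M := fun _ : U → U => Expansion D) (u := W)
        (Sum.inl f : (expLang L n).Functions k) (fun i v => v (x i))).symm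
      let χ : L.Formula U := Term.equal (Term.var (Structure.funMap f (M := U) x))
        (Term.func f fun i => Term.var (x i : U))
      have : ∀ᶠ v : U → U in W, χ.Realize v :=
        (eventually_diagFilter (χ := χ) (by simp [χ]; rfl)).filter_mono hW
      filter_upwards [this] with v hv
      exact Formula.realize_equal.1 hv
    · exact f.elim
  map_rel' {k} r x := by
    refine (relMap_quotient_mk' (L := expLang L n)
      (s := (W : Filter (U → U)).productSetoid fun _ => Expansion D) r
        (fun i v => v (x i))).trans ?_
    rcases r with r | r
    · let χ : L.Formula U := r.formula fun i => Term.var (x i : U)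
      have : ∀ᶠ v : U → U in W, (χ.Realize v ↔ χ.Realize id) :=
        (eventually_diagFilter_iff χ).filter_mono hW
      simp only [χ, Formula.realize_rel] at this
      exact (Filter.eventually_congr this).trans Filter.eventually_const
    · exact Iff.rfl

theorem realize_snoc_limitEmbedding [Nonempty U] {W : Ultrafilter (U → U)}
    (hW : (W : Filter (U → U)) ≤ diagFilter L) {k : ℕ}
    (φ : (expLang L n).BoundedFormula Empty (k + 1)) (x : Fin k → U) (a : (U → U) → U) :
    φ.Realize default (Fin.snoc (limitEmbedding hW D ∘ x)
      (limitClass W D a)) ↔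
    ∀ᶠ v : U → U in W, φ.Realize (M := Expansion D) default (Fin.snoc (v ∘ x) (a v)) := by
  have := Ultraproduct.boundedFormula_realize_cast (M := fun _ : U → U => Expansion D) (u := W) φ
    (fun i => i.elim) (Fin.snoc (α := fun _ => ∀ _ : U → U, Expansion D) (fun i v => v (x i)) a)
  refine Iff.trans (iff_of_eq ?_) (this.trans (Filter.eventually_congr (.of_forall fun v =>
    iff_of_eq ?_)))
  · congr 1
    · exact Subsingleton.elim _ _
    · exact (Fin.comp_snoc (limitClass W D) (fun i v => v (x i)) a).symm
  · congr 1
    · exact Subsingleton.elim _ _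
    · exact Fin.comp_snoc (fun g : (U → U) → U => g v) (fun i v => v (x i)) a

theorem limitSet_mem_eSet [Nonempty U] {W : Ultrafilter (U → U)}
    (hW : (W : Filter (U → U)) ≤ diagFilter L)
    (h : ∀ (k : ℕ) (φ : (expLang L n).BoundedFormula Empty (k + 1)) (x : Fin k → U),
      (∀ᶠ v : U → U in W, ∀ u, ¬ φ.Realize (M := Expansion D) default (Fin.snoc (v ∘ x) u)) ∨
      ∃ u, ∀ᶠ v : U → U in W, φ.Realize (M := Expansion D) default (Fin.snoc (v ∘ x) (v u))) :
    limitSet W D ∈ eSet L U ∅ D := by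
  let j := (limitEmbedding hW D).toElementaryEmbedding fun k φ x a ha => by
    induction a using Quotient.inductionOn with
    | _ a =>
    have ha' := (realize_snoc_limitEmbedding hW φ x a).1 ha
    rcases h k φ x with h | ⟨u, h⟩
    · obtain ⟨v, hv, hv'⟩ := (ha'.and h).exists
      exact (hv' _ hv).elim
    · exact ⟨u, (realize_snoc_limitEmbedding hW φ x fun v => v u).2 h⟩
  refine eqvOver_iff.2 fun φ => ?_
  refine (j.map_formula φ _).symm.trans ?_
  refine Iff.trans (iff_of_eq (congrArg _ (Subsingleton.elim _ _)))
    ((Ultraproduct.realize_formula_cast (M := fun _ : U → U => Expansion D) (u := W) φ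
      (fun i _ => Sum.elim Subtype.val default i)).trans Filter.eventually_const)

theorem mk_witnessTasks_le {L' : FirstOrder.Language.{u, u}} (hU : ℵ₀ ≤ #U)
    (hcard : L'.card ≤ #U) (n : ℕ) :
    #(Σ k : ℕ, (expLang L' n).BoundedFormula Empty (k + 1) × (Fin k → U)) ≤ #U := by
  have hinj : Function.Injective
      (fun t : Σ k : ℕ, (expLang L' n).BoundedFormula Empty (k + 1) × (Fin k → U) =>
        ((⟨t.1 + 1, t.2.1⟩, List.ofFn t.2.2) :
          (Σ k : ℕ, (expLang L' n).BoundedFormula Empty k) × List U)) := by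
    rintro ⟨k, φ, x⟩ ⟨k', φ', x'⟩ h
    obtain ⟨h₁, h₂⟩ := Prod.ext_iff.1 h
    obtain ⟨h₃, h₄⟩ := Sigma.ext_iff.1 h₁
    obtain rfl : k = k' := Nat.succ_injective h₃
    obtain rfl := eq_of_heq h₄
    obtain rfl := List.ofFn_injective h₂
    rfl
  have hpred : (predLang n).card ≤ ℵ₀ := by
    have : ∀ k, Countable ((predLang n).Functions k) := fun k => inferInstanceAs (Countable PEmpty)
    have : ∀ k, Countable ((predLang n).Relations k) := fun k =>
      inferInstanceAs (Countable (ULift (PLift (k = n))))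
    exact Cardinal.mk_le_aleph0
  refine (Cardinal.mk_le_of_injective hinj).trans ?_
  rw [Cardinal.mk_prod, Cardinal.lift_id, Cardinal.lift_id]
  refine Cardinal.mul_le_of_le hU ?_ ((Cardinal.mk_list_le_max U).trans (max_le hU le_rfl))
  refine BoundedFormula.card_le.trans (max_le hU ?_)
  simp only [expLang, Language.card_sum, Cardinal.mk_eq_zero, Cardinal.lift_zero, zero_add,
    Cardinal.lift_id]
  rw [Cardinal.lift_uzero]
  exact Cardinal.add_le_of_le hU hcard (hpred.trans hU)

/-- If every formula true of `b` is true of a tuple having pattern `σ` with respect to `D`, then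
`b` has pattern `σ` with respect to a set `C` with `⟨U, C⟩ ≡ ⟨U, D⟩`. -/
theorem exists_mem_eSet_of_realize (hsat : IsSatStr U iS) (hU : (#U).IsRegular)
    (hcard : L.card ≤ #U) {N : ℕ} (b : Fin N → Fin n → U) (σ : Fin N → Prop)
    (h : ∀ χ : L.Formula (Fin N × Fin n), χ.Realize (fun p => b p.1 p.2) →
      ∃ d : Fin N → Fin n → U, χ.Realize (fun p => d p.1 p.2) ∧ ∀ i, d i ∈ D ↔ σ i) :
    ∃ C ∈ eSet L U ∅ D, ∀ i, b i ∈ C ↔ σ i := by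
  have : Nonempty U := Cardinal.mk_ne_zero_iff.1 hU.pos.ne'
  let A₀ : Set U := Set.range fun p : Fin N × Fin n => b p.1 p.2
  let S₀ : Set (U → U) := {v | ∀ i, v ∘ b i ∈ D ↔ σ i}
  have hS₀ : DependsOn (· ∈ S₀) A₀ := fun v w hvw => propext <| forall_congr' fun i => by
    have : v ∘ b i = w ∘ b i := funext fun j => hvw _ ⟨(i, j), rfl⟩
    rw [this]
  have hne : (diagFilter L ⊓ Filter.principal S₀).NeBot := by
    refine Filter.inf_principal_neBot_iff.2 fun S hS => ?_
    obtain ⟨χ, hχ, hχS⟩ := mem_diagFilter.1 hS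
    obtain ⟨ψ, hψ⟩ := exists_formula_projection_pair (U := U) χ (Empty.elim : Empty → U)
      (fun x => x.elim) fun p : Fin N × Fin n => b p.1 p.2
    have hψ' : ∀ d : Fin N → Fin n → U,
        (ψ.relabel (Sum.elim Empty.elim id : Empty ⊕ _ → Fin N × Fin n)).Realize
          (fun p => d p.1 p.2) ↔
        ∃ v : U → U, (∀ i, v ∘ b i = d i) ∧ χ.Realize v := by
      intro d
      rw [Formula.realize_relabel, show (fun p : Fin N × Fin n => d p.1 p.2) ∘
        (Sum.elim Empty.elim id : Empty ⊕ _ → Fin N × Fin n) =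
        Sum.elim Empty.elim (fun p => d p.1 p.2) from
          funext fun x => by rcases x with x | x; exacts [x.elim, rfl], hψ]
      refine exists_congr fun v => ⟨fun ⟨_, hv, h⟩ => ⟨fun i => ?_, h⟩, fun ⟨hv, h⟩ => ⟨?_, ?_, h⟩⟩
      · exact funext fun j => congrFun hv (i, j)
      · exact Subsingleton.elim _ _
      · exact funext fun p => congrFun (hv p.1) p.2
    obtain ⟨d, hd, hdσ⟩ := h _ ((hψ' b).2 ⟨id, fun _ => rfl, hχ⟩)
    obtain ⟨v, hv, hvχ⟩ := (hψ' d).1 hd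
    exact ⟨v, hχS v hvχ, fun i => by rw [hv i]; exact hdσ i⟩
  obtain ⟨F, hF, hFd, hFS, hFw⟩ := exists_decided_filter hsat hU
    ((Set.finite_range _).lt_aleph0.trans_le hU.aleph0_le) hS₀ hne
    (mk_witnessTasks_le hU.aleph0_le hcard n) (fun t => Set.range t.2.2)
    (fun t => (Set.finite_range _).lt_aleph0.trans_le hU.aleph0_le)
    (fun t u v => t.2.1.Realize (M := Expansion D) default (Fin.snoc (v ∘ t.2.2) u))
    (fun t u v w hvw => by
      have : v ∘ t.2.2 = w ∘ t.2.2 := funext fun i => hvw _ ⟨i, rfl⟩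
      exact congrArg (fun y : Fin t.1 → Expansion D =>
        t.2.1.Realize default (Fin.snoc (α := fun _ => Expansion D) y u)) this)
  let W := Ultrafilter.of F
  have hW : (W : Filter (U → U)) ≤ F := Ultrafilter.of_le F
  refine ⟨limitSet W D, limitSet_mem_eSet (hW.trans hFd) fun k φ x => ?_, fun i => ?_⟩
  · exact (hFw ⟨k, φ, x⟩).imp (fun h => h.filter_mono hW) fun ⟨u, h⟩ => ⟨u, h.filter_mono hW⟩
  · have : ∀ᶠ v in W, (v ∘ b i ∈ D ↔ σ i) :=
      Filter.Eventually.filter_mono hW (Filter.mem_of_superset hFS fun v hv => hv i)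
    exact (Filter.eventually_congr this).trans Filter.eventually_const

theorem approxBelow_of_finiteVC (hsat : IsSatStr U iS) (hU : (#U).IsRegular)
    (hcard : L.card ≤ #U) (h : FiniteVC (eSet L U ∅ D)) : ApproxBelow L U D := by
  have : Nonempty U := Cardinal.mk_ne_zero_iff.1 hU.pos.ne'
  obtain ⟨N, hN⟩ := h
  refine InnerApprox.approxBelow (L := L) (by_contra fun hno => ?_)
  obtain ⟨q, hqD, hq⟩ := exists_ultrafilter_not_innerApprox hno
  let X (χ : L.Formula (Fin N × Fin n)) : Set (Fin N → Fin n → U) :=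
    {d | χ.Realize fun p => d p.1 p.2}
  let p : Set (L.Formula ((∅ : Set U) ⊕ Fin N × Fin n)) :=
    {χ | {d | χ.Realize (Sum.elim Subtype.val fun p => d p.1 p.2)} ∈ ultraPow q N}
  obtain ⟨b, hb⟩ := hsat.exists_realize (A := ∅) (by simpa using hU.pos) p fun s hs => by
    obtain ⟨d, hd⟩ := (ultraPow q N).nonempty_of_mem ((Filter.biInter_finset_mem s).2 hs)
    refine ⟨fun p => d p.1 p.2, fun φ hφ => ?_⟩
    simp only [Set.mem_iInter] at hd
    exact hd φ hφ
  have hX : ∀ χ : L.Formula (Fin N × Fin n), χ.Realize b → X χ ∈ ultraPow q N := by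
    intro χ hχ
    by_contra hno
    let χ' : L.Formula ((∅ : Set U) ⊕ Fin N × Fin n) := Formula.relabel Sum.inr (∼χ)
    have hχ' : ∀ c : Fin N × Fin n → U,
        χ'.Realize (Sum.elim Subtype.val c) ↔ ¬ χ.Realize c := fun c => by
      rw [Formula.realize_relabel, Sum.elim_comp_inr, Formula.realize_not]
    refine (hχ' b).1 (hb χ' ?_) hχ
    change {d : Fin N → Fin n → U | _} ∈ ultraPow q N
    simp only [hχ']
    exact Ultrafilter.compl_mem_iff_notMem.2 hno
  have key (σ : Fin N → Prop) : ∃ C ∈ eSet L U ∅ D, ∀ i, (fun j => b (i, j)) ∈ C ↔ σ i := by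
    refine exists_mem_eSet_of_realize hsat hU hcard (fun i j => b (i, j)) σ fun χ hχ => ?_
    refine exists_pattern hqD hq σ (X χ) ⟨χ.relabel Sum.inr, fun d => ?_⟩ (hX χ hχ)
    rw [Formula.realize_relabel, Sum.elim_comp_inr]
    rfl
  have hinj : Function.Injective fun (i : Fin N) (j : Fin n) => b (i, j) := by
    intro i i' hii
    obtain ⟨C, _, hC⟩ := key fun k => k = i
    have h₁ := (hC i).2 rfl
    rw [show (fun j => b (i, j)) = fun j => b (i', j) from hii] at h₁
    exact ((hC i').1 h₁).symm
  classical
  refine hN (Finset.univ.map ⟨_, hinj⟩) (by simp) fun H hH => ?_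
  obtain ⟨C, hC, hCb⟩ := key fun i => (fun j => b (i, j)) ∈ H
  refine ⟨C, hC, ?_⟩
  ext z
  constructor
  · rintro ⟨hz, hz'⟩
    obtain ⟨i, rfl⟩ : ∃ i, (fun j => b (i, j)) = z := by simpa using hz'
    exact (hCb i).1 hz
  · intro hz
    obtain ⟨i, rfl⟩ : ∃ i, (fun j => b (i, j)) = z := by simpa using hH hz
    exact ⟨(hCb i).2 hz, hH hz⟩

end Resplendence

section Traces

variable {U L} {n : ℕ} {D : Set (Fin n → U)}

theorem frealize_expStr_onFormula {α : Type*} (C : Set (Fin n → U)) (φ : L.Formula α) (v : α → U) :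
    FRealize U (expStr L U C) (LHom.sumInl.onFormula φ) v ↔ φ.Realize v := by
  let : (L.sum (predLang n)).Structure U := expStr L U C
  have : (LHom.sumInl : L →ᴸ L.sum (predLang n)).IsExpansionOn U :=
    ⟨fun _ _ => rfl, fun _ _ => rfl⟩
  exact LHom.realize_onFormula (L' := L.sum (predLang n)) LHom.sumInl φ

theorem finiteVC_of_approxBelow (hnip : TheoryNIP L U) (h : ApproxBelow L U D) :
    FiniteVC (eSet L U ∅ D) := by
  classical
  obtain ⟨m, φ, hφ⟩ := h
  obtain ⟨N, hN⟩ := hnip m n φ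
  refine ⟨N, fun B hB hsh => hN B hB ?_⟩
  let φ' : (expLang L n).Formula (Fin m ⊕ Fin n) := LHom.sumInl.onFormula φ
  let r : (expLang L n).Relations n := Sum.inr ⟨⟨rfl⟩⟩
  let θ : (expLang L n).Formula ((∅ : Set U) ⊕ Empty) :=
    Formula.iAlls (Fin N × Fin n) (Formula.iExs (Fin m) (Formula.iInf fun i : Fin N =>
      (φ'.relabel (Sum.elim Sum.inr fun j => Sum.inl (Sum.inr (i, j)))).iff
        (r.formula fun j => Term.var (Sum.inl (Sum.inr (i, j))))))
  have hθ : ∀ C : Set (Fin n → U), FRealize U (expStr L U C) θ (Sum.elim Subtype.val default) ↔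
      ∀ z : Fin N × Fin n → U, ∃ b : Fin m → U, ∀ i,
        (fun j => z (i, j)) ∈ phiSet L U φ b ↔ (fun j => z (i, j)) ∈ C := by
    intro C
    let := expStr L U C
    simp only [FRealize, θ, Formula.realize_iAlls, Formula.realize_iExs, Formula.realize_iInf,
      Formula.realize_iff, Formula.realize_relabel, Formula.realize_rel]
    refine forall_congr' fun z => exists_congr fun b => forall_congr' fun i => iff_congr ?_ Iff.rfl
    refine (frealize_expStr_onFormula C φ _).trans (iff_of_eq (congrArg _ (funext fun x => ?_)))
    rcases x with x | x <;> rfl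
  have hD : FRealize U (expStr L U D) θ (Sum.elim Subtype.val default) := by
    refine (hθ D).2 fun z => ?_
    obtain ⟨b, hb, -⟩ := hφ (Finset.univ.image z)
    refine ⟨b, fun i => ?_⟩
    have hi : (fun j => z (i, j)) ∈ tuplesIn U (↑(Finset.univ.image z) : Set U) := fun j => by simp
    have := Set.ext_iff.1 hb fun j => z (i, j)
    rwa [Set.mem_inter_iff, Set.mem_inter_iff, and_iff_left hi, and_iff_left hi] at this
  intro H hH
  obtain ⟨C, hC, hCH⟩ := hsh H hH
  obtain ⟨e⟩ : Nonempty (Fin N ≃ B) := ⟨(B.equivFinOfCardEq hB).symm⟩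
  obtain ⟨b, hb⟩ := (hθ C).1 ((eqvOver_iff.1 hC θ).2 hD) fun p => (e p.1 : Fin n → U) p.2
  refine ⟨phiSet L U φ b, ⟨b, rfl⟩, ?_⟩
  rw [← hCH]
  ext z
  refine and_congr_left fun hz => ?_
  simpa using hb (e.symm ⟨z, hz⟩)

end Traces

/-- if `T` is NIP, `D` is approximable from below iff `e(D)` has finite
VC dimension. -/
theorem stmt10 (L : FirstOrder.Language.{u, u}) (U : Type u) [iS : L.Structure U]
    (hsat : IsSatStr U iS) (hinacc : Cardinal.IsInaccessible #U) (hcard : L.card < #U)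
    (hnip : TheoryNIP L U)
    (n : ℕ) (D : Set (Fin n → U)) :
    ApproxBelow L U D ↔ FiniteVC (eSet L U (∅ : Set U) D) := by
  exact ⟨finiteVC_of_approxBelow hnip,
    approxBelow_of_finiteVC hsat hinacc.isRegular hcard.le⟩

end Paper
end

section
/- If D ⊆ U^{|z|} is approximable by a formula φ(x,z) that is NIP, then D is approximable from below (by some formula, not necessarily φ). No global assumption on T is needed. -/
namespace Paper

open FirstOrder Language Cardinal Set

universe u

variable (L : FirstOrder.Language.{u, u}) (U : Type u) [iS : L.Structure U]

open Filter

/-- Countable saturation of the ultrapower along the hyperfilter on `ℕ`. -/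
theorem exists_forall_eventually_of_finite {X : Type*} (P : ℕ → ℕ → X → Prop)
    (h : ∀ m, ∀ᶠ i in (hyperfilter ℕ : Filter ℕ), ∃ x, ∀ k < m, P k i x) :
    ∃ f : ℕ → X, ∀ k, ∀ᶠ i in (hyperfilter ℕ : Filter ℕ), P k i (f i) := by
  classical
  obtain ⟨i₀, x₀, -⟩ := (h 0).exists
  have hex : ∀ i, ∃ x, ∀ k < Nat.findGreatest (fun m => ∃ x, ∀ k < m, P k i x) i, P k i x :=
    fun i => Nat.findGreatest_spec (P := fun m => ∃ x, ∀ k < m, P k i x) (Nat.zero_le i)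
      ⟨x₀, fun k hk => absurd hk (Nat.not_lt_zero k)⟩
  choose f hf using hex
  refine ⟨f, fun k => ?_⟩
  filter_upwards [h (k + 1), Nat.hyperfilter_le_atTop (eventually_ge_atTop (k + 1))] with i hi hk
  exact hf i k (Nat.lt_of_succ_le (Nat.le_findGreatest hk hi))

/-- The set of indices `S` is cut out on the tuple `w` by a member of the family `F`. -/
def CutsOut {X : Type*} (F : Set (Set X)) {N : ℕ} (S : Finset (Fin N)) (w : Fin N → X) : Prop :=
  ∃ E ∈ F, ∀ j, w j ∈ E ↔ j ∈ S

/-- `CutsOut` for tuples of elements of the ultrapower along the hyperfilter on `ℕ`, the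
elements being given by representatives. -/
def StarCutsOut {X : Type*} (F : Set (Set X)) {N : ℕ} (S : Finset (Fin N))
    (w : Fin N → ℕ → X) : Prop :=
  ∀ᶠ i in (hyperfilter ℕ : Filter ℕ), CutsOut F S (fun j => w j i)

/-- `z` realizes over the parameters `C` the coheir type given by the ultrafilter `q`, with
respect to the formulas `CutsOut F S`. -/
def RealizesOver {X : Type*} (F : Set (Set X)) (N : ℕ) (q : Ultrafilter X) (C : Set (ℕ → X))
    (z : ℕ → X) : Prop :=
  ∀ (S : Finset (Fin N)) (j : Fin N) (w : Fin N → ℕ → X), (∀ k, w k ∈ C) →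
    (StarCutsOut F S (Function.update w j z) ↔
      ∀ᶠ a in (q : Filter X), StarCutsOut F S (Function.update w j fun _ => a))

theorem update_apply_apply {X : Type*} {N : ℕ} (w : Fin N → ℕ → X) (j : Fin N) (z : ℕ → X)
    (i : ℕ) : (fun k => Function.update w j z k i) = Function.update (fun k => w k i) j (z i) := by
  ext k
  by_cases h : k = j
  · subst h; simp
  · simp [h]

theorem eventually_iff_const {I : Type*} (U : Ultrafilter I) (P : I → Prop) (Q : Prop) :
    (∀ᶠ i in (U : Filter I), (P i ↔ Q)) ↔ ((∀ᶠ i in (U : Filter I), P i) ↔ Q) := by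
  by_cases hQ : Q
  · simp only [hQ, iff_true]
  · simp only [hQ, iff_false, Ultrafilter.eventually_not]

theorem exists_realizesOver_countable {X : Type*} {F : Set (Set X)} {N : ℕ} {q : Ultrafilter X}
    {G : Set X}
    (h : ∀ C : Finset (ℕ → X), ∃ z, (∀ᶠ i in (hyperfilter ℕ : Filter ℕ), z i ∈ G) ∧
      RealizesOver F N q C z)
    {C : Set (ℕ → X)} (hC : C.Countable) :
    ∃ z, (∀ᶠ i in (hyperfilter ℕ : Filter ℕ), z i ∈ G) ∧ RealizesOver F N q C z := by
  classical
  have := hC.to_subtype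
  obtain ⟨e, he⟩ := Countable.exists_injective_nat (Finset (Fin N) × Fin N × (Fin N → C))
  obtain ⟨z, hz⟩ := exists_forall_eventually_of_finite
    (fun k i x => x ∈ G ∧ ∀ t : Finset (Fin N) × Fin N × (Fin N → C), e t = k →
      (CutsOut F t.1 (Function.update (fun l => (t.2.2 l : ℕ → X) i) t.2.1 x) ↔
        ∀ᶠ a in (q : Filter X),
          StarCutsOut F t.1 (Function.update (fun l => (t.2.2 l : ℕ → X)) t.2.1 fun _ => a)))
    (fun m => by
      have hfin : {t | e t < m}.Finite := (Set.finite_lt_nat m).preimage he.injOn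
      obtain ⟨z, hzG, hz⟩ := h (hfin.toFinset.biUnion fun t =>
        Finset.univ.image fun l => (t.2.2 l : ℕ → X))
      have hall : ∀ᶠ i in (hyperfilter ℕ : Filter ℕ), ∀ t ∈ {t | e t < m},
          (CutsOut F t.1 (Function.update (fun l => (t.2.2 l : ℕ → X) i) t.2.1 (z i)) ↔
            ∀ᶠ a in (q : Filter X), StarCutsOut F t.1
              (Function.update (fun l => (t.2.2 l : ℕ → X)) t.2.1 fun _ => a)) := by
        rw [Filter.eventually_all_finite hfin]
        intro t ht
        rw [eventually_iff_const]
        have := hz t.1 t.2.1 (fun l => (t.2.2 l : ℕ → X)) (fun k => by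
          simp only [Finset.coe_biUnion, Set.mem_iUnion]
          exact ⟨t, by simpa using ht, by simp⟩)
        rw [← this]
        simp only [StarCutsOut, update_apply_apply]
      filter_upwards [hzG, hall] with i hiG hi
      exact ⟨z i, fun k hk => ⟨hiG, fun t ht => hi t (by simpa [ht] using hk)⟩⟩)
  refine ⟨z, (hz 0).mono fun i hi => hi.1, fun S j w hw => ?_⟩
  have := (hz (e (S, j, fun k => ⟨w k, hw k⟩))).mono fun i hi => hi.2 _ rfl
  rw [eventually_iff_const] at this
  simpa only [StarCutsOut, update_apply_apply] using this

/-- A sequence each of whose terms is chosen according to the finite set of the earlier terms. -/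
noncomputable def seqOfEarlier {Y : Type*} (f : ℕ → Set Y → Y) : ℕ → Y
  | k => f k (Set.range fun j : Fin k => seqOfEarlier f j)
decreasing_by exact j.2

/-- Increasing subsequences of a coheir sequence have the same type. -/
theorem starCutsOut_comp_iff {X : Type*} {F : Set (Set X)} {N : ℕ} {q : Ultrafilter X} {A : Set X}
    (hA : A ∈ q) {a : ℕ → ℕ → X}
    (ha : ∀ k, RealizesOver F N q ((fun x _ => x) '' A ∪ Set.range fun j : Fin k => a j) (a k))
    (S : Finset (Fin N)) {ι : ℕ → ℕ} (hι : StrictMono ι) :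
    StarCutsOut F S (fun j : Fin N => a (ι j)) ↔ StarCutsOut F S (fun j : Fin N => a j) := by
  let W : (ℕ → ℕ) → ℕ → (Fin N → X) → Fin N → ℕ → X :=
    fun ι k α j => if (j : ℕ) < k then a (ι j) else fun _ => α j
  have hstep : ∀ (ι : ℕ → ℕ) (k : Fin N) (α : Fin N → X),
      W ι (k + 1) α = Function.update (W ι k α) k (a (ι k)) := by
    intro ι k α
    ext j i
    rcases lt_trichotomy j k with h | h | h
    · have h' : (j : ℕ) < k := h
      simp [W, h.ne, h, h'.trans (Nat.lt_succ_self _)]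
    · subst h; simp [W]
    · have h' : (k : ℕ) < j := h
      simp [W, h.ne', h.not_gt, show ¬ (j : ℕ) < k + 1 by omega]
  have hconst : ∀ (ι : ℕ → ℕ) (k : Fin N) (α : Fin N → X) (x : X),
      Function.update (W ι k α) k (fun _ => x) = W ι k (Function.update α k x) := by
    intro ι k α x
    ext j i
    by_cases h : j = k
    · subst h; simp [W]
    · simp [W, h]
  have hmem : ∀ (ι : ℕ → ℕ), StrictMono ι → ∀ (k : Fin N) (α : Fin N → X), (∀ j, α j ∈ A) →
      ∀ j, W ι k α j ∈ (fun x (_ : ℕ) => x) '' A ∪ Set.range fun j : Fin (ι k) => a j := by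
    intro ι hι k α hα j
    by_cases h : (j : ℕ) < k
    · right
      exact ⟨⟨ι j, hι h⟩, by simp [W, h]⟩
    · left
      exact ⟨α j, hα j, by simp [W, h]⟩
  have key : ∀ k ≤ N, ∀ α : Fin N → X, (∀ j, α j ∈ A) →
      (StarCutsOut F S (W ι k α) ↔ StarCutsOut F S (W id k α)) := by
    intro k
    induction k with
    | zero => intro _ α _; simp [W]
    | succ k ih =>
      intro hk α hα
      have h1 := hstep ι ⟨k, hk⟩ α
      have h2 := hstep id ⟨k, hk⟩ α
      simp only at h1 h2
      rw [h1, h2, ha _ S ⟨k, hk⟩ _ (hmem ι hι ⟨k, hk⟩ α hα),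
        ha _ S ⟨k, hk⟩ _ (hmem id strictMono_id ⟨k, hk⟩ α hα)]
      refine Filter.eventually_congr (Filter.mem_of_superset hA fun x hx => ?_)
      have h3 := hconst ι ⟨k, hk⟩ α x
      have h4 := hconst id ⟨k, hk⟩ α x
      simp only at h3 h4
      change StarCutsOut F S _ ↔ StarCutsOut F S _
      rw [h3, h4]
      refine ih (by omega) _ fun j => ?_
      by_cases h : j = ⟨k, hk⟩
      · subst h; simpa using hx
      · simpa [h] using hα j
  obtain ⟨x, hx⟩ := Ultrafilter.nonempty_of_mem hA
  simpa [W] using key N le_rfl (fun _ => x) fun _ => hx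

/-- A coheir sequence cannot alternate between `D` and its complement, if `D` is approximated
by a family of finite VC-dimension. -/
theorem not_alternating {X : Type*} {F : Set (Set X)} {D : Set X} {N : ℕ}
    (hF : ∀ B : Finset X, B.card = N → ¬Shatters F ↑B)
    (hD : ∀ w : Fin N → X, ∃ E ∈ F, ∀ j, w j ∈ E ↔ w j ∈ D)
    {q : Ultrafilter X} {A : Set X} (hA : A ∈ q) {a : ℕ → ℕ → X}
    (ha : ∀ k, RealizesOver F N q ((fun x _ => x) '' A ∪ Set.range fun j : Fin k => a j) (a k))
    (haD : ∀ k, ∀ᶠ i in (hyperfilter ℕ : Filter ℕ), a k i ∈ D ↔ Even k) : False := by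
  classical
  have hall : ∀ S : Finset (Fin N), StarCutsOut F S (fun j : Fin N => a j) := by
    intro S
    let ι : ℕ → ℕ := fun k => 2 * k + if ∃ h : k < N, (⟨k, h⟩ : Fin N) ∈ S then 0 else 1
    have hι : StrictMono ι := by
      refine strictMono_nat_of_lt_succ fun k => ?_
      simp only [ι]
      split_ifs <;> omega
    rw [← starCutsOut_comp_iff hA ha S hι]
    have := Filter.eventually_all.2 fun j : Fin N => haD (ι j)
    filter_upwards [this] with i hi
    obtain ⟨E, hE, hED⟩ := hD fun j => a (ι j) i
    refine ⟨E, hE, fun j => ?_⟩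
    rw [hED, hi]
    by_cases hj : j ∈ S
    · simp [ι, hj]
    · simp [ι, hj]
  obtain ⟨i, hi⟩ := (Filter.eventually_all.2 hall).exists
  have hinj : Function.Injective fun j : Fin N => a j i := by
    intro j k hjk
    obtain ⟨E, -, hE⟩ := hi {j}
    have h1 : a j i ∈ E := (hE j).2 (by simp)
    have hjk : a j i = a k i := hjk
    rw [hjk] at h1
    exact (Finset.mem_singleton.1 ((hE k).1 h1)).symm
  refine hF (Finset.univ.image fun j : Fin N => a j i)
    (by rw [Finset.card_image_of_injective _ hinj]; simp) fun H hH => ?_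
  obtain ⟨E, hE, hES⟩ := hi (Finset.univ.filter fun j => a j i ∈ H)
  refine ⟨E, hE, Set.ext fun x => ⟨?_, fun hx => ?_⟩⟩
  · rintro ⟨hxE, hx⟩
    obtain ⟨j, -, rfl⟩ := by simpa only [Finset.coe_image, Set.mem_image] using hx
    simpa using (hES j).1 hxE
  · have hx' := hH hx
    obtain ⟨j, -, rfl⟩ := by simpa only [Finset.coe_image, Set.mem_image] using hx'
    exact ⟨(hES j).2 (by simpa using hx), hx'⟩

/-- The set of formulas `CutsOut F S` over the parameters `c` satisfied by `z`. -/
def cutsPattern {X : Type*} (F : Set (Set X)) (N : ℕ) {K : Type*} (c : K → X) (z : X) :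
    Set (Finset (Fin N) × Fin N × (Fin N → K)) :=
  {t | CutsOut F t.1 (Function.update (c ∘ t.2.2) t.2.1 z)}

/-- A set approximated by a family of finite VC-dimension has uniform honest definitions. -/
theorem exists_uniform_honest_definition {X : Type*} {F : Set (Set X)} {D : Set X} {N : ℕ}
    (hF : ∀ B : Finset X, B.card = N → ¬Shatters F ↑B)
    (hD : ∀ w : Fin N → X, ∃ E ∈ F, ∀ j, w j ∈ E ↔ w j ∈ D) :
    ∃ K : ℕ, ∀ A : Set X, A.Finite → A ⊆ D →
      ∃ c : Fin K → X, ∀ a ∈ A, ∀ z, cutsPattern F N c z = cutsPattern F N c a → z ∈ D := by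
  classical
  by_contra! hcon
  choose A hAfin hAD hA using hcon
  have hstar : ∀ C : Finset (ℕ → X), ∃ a ∈ ⋃ K, A K, ∃ z : ℕ → X,
      (∀ᶠ i in (hyperfilter ℕ : Filter ℕ), z i ∈ Dᶜ) ∧
      ∀ (S : Finset (Fin N)) (j : Fin N) (w : Fin N → ℕ → X), (∀ k, w k ∈ C) →
        (StarCutsOut F S (Function.update w j z) ↔
          StarCutsOut F S (Function.update w j fun _ => a)) := by
    intro C
    choose b hb z hz hzD using fun i => hA C.card fun k => (C.equivFin.symm k : ℕ → X) i
    obtain ⟨a, ha, hba⟩ : ∃ a ∈ A C.card, {i | b i = a} ∈ hyperfilter ℕ := by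
      rw [← Ultrafilter.finite_biUnion_mem_iff (hAfin _)]
      exact Filter.mem_of_superset Filter.univ_mem fun i _ => by simpa using hb i
    refine ⟨a, Set.mem_iUnion.2 ⟨_, ha⟩, z, Filter.Eventually.of_forall hzD,
      fun S j w hw => Filter.eventually_congr ?_⟩
    filter_upwards [hba] with i hi
    have hi : b i = a := hi
    rw [update_apply_apply, update_apply_apply, ← hi]
    have := Set.ext_iff.1 (hz i) (S, j, fun k => C.equivFin ⟨w k, hw k⟩)
    simpa [cutsPattern, Function.comp_def] using this
  choose α hα ζ hζD hζ using hstar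
  let q : Ultrafilter X := (Ultrafilter.of (atTop : Filter (Finset (ℕ → X)))).map α
  have hqA : (⋃ K, A K) ∈ q :=
    Ultrafilter.mem_map.2 (Filter.mem_of_superset Filter.univ_mem fun C _ => hα C)
  have hAD' : (⋃ K, A K) ⊆ D := Set.iUnion_subset hAD
  have hdecide : ∀ C : Finset (ℕ → X), ∀ᶠ a in (q : Filter X),
      ∀ t : Finset (Fin N) × Fin N × (Fin N → C),
        (StarCutsOut F t.1 (Function.update (fun l => (t.2.2 l : ℕ → X)) t.2.1 fun _ => a) ↔
          ∀ᶠ a in (q : Filter X),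
            StarCutsOut F t.1 (Function.update (fun l => (t.2.2 l : ℕ → X)) t.2.1 fun _ => a)) :=
    fun C => Filter.eventually_all.2 fun t => by rw [eventually_iff_const]
  have hin : ∀ C : Finset (ℕ → X), ∃ z, (∀ᶠ i in (hyperfilter ℕ : Filter ℕ), z i ∈ D) ∧
      RealizesOver F N q C z := by
    intro C
    obtain ⟨a, ha, haA⟩ := ((hdecide C).and hqA).exists
    exact ⟨fun _ => a, Filter.Eventually.of_forall fun _ => hAD' haA,
      fun S j w hw => ha (S, j, fun k => ⟨w k, hw k⟩)⟩
  have hout : ∀ C : Finset (ℕ → X), ∃ z, (∀ᶠ i in (hyperfilter ℕ : Filter ℕ), z i ∈ Dᶜ) ∧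
      RealizesOver F N q C z := by
    intro C
    have h1 : ∀ᶠ C' in (Ultrafilter.of (atTop : Filter (Finset (ℕ → X))) : Filter _), C ⊆ C' :=
      Ultrafilter.of_le _ (eventually_ge_atTop C)
    have h2 := hdecide C
    rw [Ultrafilter.coe_map, Filter.eventually_map] at h2
    obtain ⟨C', hC', h⟩ := (h1.and h2).exists
    exact ⟨ζ C', hζD C', fun S j w hw => (hζ C' S j w fun k => hC' (hw k)).trans
      (h (S, j, fun k => ⟨w k, hw k⟩))⟩
  have hnext : ∀ (k : ℕ) (C : Set (ℕ → X)), ∃ z, C.Countable →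
      (∀ᶠ i in (hyperfilter ℕ : Filter ℕ), z i ∈ D ↔ Even k) ∧ RealizesOver F N q C z := by
    intro k C
    by_cases hC : C.Countable
    · by_cases hk : Even k
      · obtain ⟨z, h1, h2⟩ := exists_realizesOver_countable hin hC
        exact ⟨z, fun _ => ⟨h1.mono fun i hi => by simpa [hk] using hi, h2⟩⟩
      · obtain ⟨z, h1, h2⟩ := exists_realizesOver_countable hout hC
        exact ⟨z, fun _ => ⟨h1.mono fun i hi => by simpa [hk] using hi, h2⟩⟩
    · exact ⟨ζ ∅, fun h => absurd h hC⟩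
  choose f hf using hnext
  let a := seqOfEarlier fun k C => f k ((fun x _ => x) '' (⋃ K, A K) ∪ C)
  have ha : ∀ k, (∀ᶠ i in (hyperfilter ℕ : Filter ℕ), a k i ∈ D ↔ Even k) ∧
      RealizesOver F N q
        ((fun x _ => x) '' (⋃ K, A K) ∪ Set.range fun j : Fin k => a j) (a k) := by
    intro k
    have hcount : ((fun x _ => x) '' (⋃ K, A K) ∪ Set.range fun j : Fin k => a j).Countable :=
      ((Set.countable_iUnion fun K => (hAfin K).countable).image _).union (Set.countable_range _)
    have := hf k _ hcount
    have hak : a k = f k ((fun x _ => x) '' (⋃ K, A K) ∪ Set.range fun j : Fin k => a j) := by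
      simp only [a]
      rw [seqOfEarlier]
    rwa [← hak] at this
  exact not_alternating hF hD hqA (fun k => (ha k).2) fun k => (ha k).1

section Formulas

variable {L U}

/-- The formula `ψ` or its negation, according to whether `p` holds. -/
noncomputable def signed {α : Type*} (p : Prop) (ψ : L.Formula α) : L.Formula α :=
  open Classical in if p then ψ else ψ.not

theorem realize_signed {α : Type*} (p : Prop) (ψ : L.Formula α) (v : α → U) :
    (signed p ψ).Realize v ↔ (ψ.Realize v ↔ p) := by
  by_cases hp : p <;> simp [signed, hp]

/-- The formula saying that `S` is cut out on a tuple by an instance of `φ`. -/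
noncomputable def cutsFormula {m n N : ℕ} (φ : L.Formula (Fin m ⊕ Fin n)) (S : Finset (Fin N)) :
    L.Formula (Fin N × Fin n) :=
  Formula.iExs (Fin m) (Formula.iInf fun j : Fin N =>
    signed (j ∈ S) (φ.relabel (Sum.elim Sum.inr fun l => Sum.inl (j, l))))

theorem realize_cutsFormula {m n N : ℕ} (φ : L.Formula (Fin m ⊕ Fin n)) (S : Finset (Fin N))
    (v : Fin N × Fin n → U) :
    (cutsFormula φ S).Realize v ↔
      CutsOut {E : Set (Fin n → U) | ∃ b : Fin m → U, E = phiSet L U φ b} S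
        (fun j l => v (j, l)) := by
  have hrel : ∀ (b : Fin m → U) (j : Fin N),
      (φ.relabel (Sum.elim Sum.inr fun l => Sum.inl (j, l)) :
        L.Formula ((Fin N × Fin n) ⊕ Fin m)).Realize (Sum.elim v b) ↔
      (fun l => v (j, l)) ∈ phiSet L U φ b := by
    intro b j
    rw [Formula.realize_relabel]
    change _ ↔ φ.Realize _
    congr! 1
    ext (l | l) <;> rfl
  simp only [cutsFormula, Formula.realize_iExs, Formula.realize_iInf, realize_signed, hrel]
  constructor
  · rintro ⟨b, hb⟩
    exact ⟨_, ⟨b, rfl⟩, hb⟩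
  · rintro ⟨_, ⟨b, rfl⟩, hb⟩
    exact ⟨b, hb⟩

theorem exists_formula_cutsPattern {m n : ℕ} (φ : L.Formula (Fin m ⊕ Fin n)) (N K : ℕ)
    (P : Set (Set (Finset (Fin N) × Fin N × (Fin N → Fin K)))) :
    ∃ ψ : L.Formula (Fin (K * n) ⊕ Fin n), ∀ c : Fin K → Fin n → U, ∃ b : Fin (K * n) → U,
      ∀ z, z ∈ phiSet L U ψ b ↔
        cutsPattern {E : Set (Fin n → U) | ∃ b : Fin m → U, E = phiSet L U φ b} N c z ∈ P := by
  let ψ : L.Formula (Fin (K * n) ⊕ Fin n) := Formula.iSup fun p : P => Formula.iInf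
    fun t : Finset (Fin N) × Fin N × (Fin N → Fin K) => signed (t ∈ p.1)
      ((cutsFormula φ t.1).relabel fun q =>
        if q.1 = t.2.1 then Sum.inr q.2 else Sum.inl (finProdFinEquiv (t.2.2 q.1, q.2)))
  refine ⟨ψ, fun c => ⟨fun i => c (finProdFinEquiv.symm i).1 (finProdFinEquiv.symm i).2,
    fun z => ?_⟩⟩
  change ψ.Realize _ ↔ _
  have hupd : ∀ t : Finset (Fin N) × Fin N × (Fin N → Fin K),
      (fun j l => (Sum.elim (fun i => c (finProdFinEquiv.symm i).1 (finProdFinEquiv.symm i).2) z ∘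
        fun q : Fin N × Fin n => if q.1 = t.2.1 then Sum.inr q.2
          else Sum.inl (finProdFinEquiv (t.2.2 q.1, q.2))) (j, l)) =
      Function.update (c ∘ t.2.2) t.2.1 z := by
    intro t
    ext j l
    by_cases h : j = t.2.1
    · simp [h]
    · simp only [Function.comp_apply, h, if_false, Sum.elim_inl, Equiv.symm_apply_apply,
        Function.update_of_ne h]
  simp only [ψ, Formula.realize_iSup, Formula.realize_iInf, realize_signed,
    Formula.realize_relabel, realize_cutsFormula, hupd]
  constructor
  · rintro ⟨p, hp⟩
    convert p.2
    ext t
    exact hp t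
  · intro h
    exact ⟨⟨_, h⟩, fun t => Iff.rfl⟩

end Formulas

/-- if `D` is approximable by an NIP formula, then `D` is approximable from
below (by some formula). No global assumption on `T` is needed. -/
theorem stmt11 (L : FirstOrder.Language.{u, u}) (U : Type u) [iS : L.Structure U]
    (hsat : IsSatStr U iS) (hinacc : Cardinal.IsInaccessible #U) (hcard : L.card < #U)
    (n m : ℕ) (φ : L.Formula (Fin m ⊕ Fin n)) (hφ : FormulaNIP L U φ)
    (D : Set (Fin n → U)) (hD : ApproxBy L U D φ) :
    ApproxBelow L U D := by
  classical
  obtain ⟨N, hN⟩ := hφ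
  obtain ⟨K, hK⟩ := exists_uniform_honest_definition (D := D) hN fun w => by
    obtain ⟨b, hb⟩ := hD (Finset.univ.biUnion fun j => Finset.univ.image (w j))
    refine ⟨_, ⟨b, rfl⟩, fun j => ?_⟩
    have hw : w j ∈ tuplesIn U
        (↑(Finset.univ.biUnion fun j => Finset.univ.image (w j)) : Set U) := fun l =>
      Finset.mem_coe.2 (Finset.mem_biUnion.2
        ⟨j, Finset.mem_univ _, Finset.mem_image_of_mem _ (Finset.mem_univ l)⟩)
    simpa only [Set.mem_inter_iff, hw, and_true] using (Set.ext_iff.1 hb (w j))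
  choose ψ hψ using exists_formula_cutsPattern (U := U) φ N K
  by_contra hcon
  have hfail : ∀ P, ∃ B : Finset U, ¬∃ b, phiSet L U (ψ P) b ∩ tuplesIn U ↑B =
      D ∩ tuplesIn U ↑B ∧ phiSet L U (ψ P) b ⊆ D := fun P => by
    by_contra! h
    exact hcon ⟨_, ψ P, h⟩
  choose B hB using hfail
  have hfin : (tuplesIn U (⋃ P, (B P : Set U)) : Set (Fin n → U)).Finite := by
    simpa [tuplesIn, Set.pi] using Set.Finite.pi fun _ : Fin n =>
      Set.finite_iUnion fun P => (B P).finite_toSet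
  obtain ⟨c, hc⟩ := hK (D ∩ tuplesIn U (⋃ P, (B P : Set U))) (hfin.inter_of_right D)
    Set.inter_subset_left
  obtain ⟨b, hb⟩ := hψ (cutsPattern _ N c '' (D ∩ tuplesIn U (⋃ P, (B P : Set U)))) c
  have hsub : phiSet L U (ψ _) b ⊆ D := fun z hz => by
    obtain ⟨a, ha, haz⟩ := (hb z).1 hz
    exact hc a ha z haz.symm
  refine hB _ ⟨b, Set.Subset.antisymm (fun z hz => ⟨hsub hz.1, hz.2⟩) fun z hz => ⟨?_, hz.2⟩, hsub⟩
  exact (hb z).2 ⟨z, ⟨hz.1, fun i => Set.mem_iUnion.2 ⟨_, hz.2 i⟩⟩, rfl⟩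

end Paper
end

section
/- For every D ⊆ U^{|z|} and every small A ⊆ M ⪯ U the following are equivalent: (1) D is Lascar invariant over A; (2) every set in o(D/A) is M-invariant; (3) o(D/A) has cardinality < κ; (4) every endless A-indiscernible sequence is indiscernible in L(A;D); (5) for every A-indiscernible sequence ⟨c_i : i < ω⟩ of |z|-tuples, c_0 ∈ D ↔ c_1 ∈ D. -/
namespace Paper

open FirstOrder Language Cardinal Set

universe u

variable (L : FirstOrder.Language.{u, u}) (U : Type u) [iS : L.Structure U]

section Auxiliary

variable {L U}

theorem fRealize_addConsts_iff {L' : FirstOrder.Language.{u, u}} (S : L'.Structure U) (A : Set U)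
    {α : Type*} (φ : (L'[[↥A]]).Formula α) (v : α → U) :
    FRealize U (addConsts U S A) φ v ↔
      FRealize U S (BoundedFormula.constantsVarsEquiv φ : L'.Formula (A ⊕ α))
        (Sum.elim Subtype.val v) := by
  let _ := S
  exact (BoundedFormula.realize_constantsVarsEquiv (L := L') (α := A) (M := U)).symm

/-- A saturated structure realizes the type of a filter over any small family of parameters. -/
theorem IsSatStr.exists_realize_s13 (hsat : IsSatStr U iS) {ι : Type u} (hι : #ι < #U) (w : ι → U)
    {X : Type*} [Finite X] (F : Filter (X → U)) [F.NeBot] :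
    ∃ t : X → U, ∀ φ : L.Formula (ι ⊕ X),
      (∀ᶠ m in F, φ.Realize (Sum.elim w m)) → φ.Realize (Sum.elim w t) := by
  obtain ⟨k, ⟨e⟩⟩ := Finite.exists_equiv_fin X
  obtain ⟨b, hb⟩ := hsat (Set.range w) (mk_range_le.trans_lt hι) k
    {ψ | ∀ᶠ m in F, FRealize U (addConsts U iS (Set.range w)) ψ (m ∘ e.symm)} (by
      intro s hs
      have : ∀ᶠ m in F, ∀ φ ∈ s, FRealize U (addConsts U iS (Set.range w)) φ (m ∘ e.symm) :=
        (Filter.eventually_all_finset s).2 fun φ hφ => hs hφ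
      obtain ⟨m, hm⟩ := this.exists
      exact ⟨_, hm⟩)
  have key : ∀ (φ : L.Formula (ι ⊕ X)) (m : X → U),
      FRealize U (addConsts U iS (Set.range w))
        ((BoundedFormula.constantsVarsEquiv (n := 0)).symm
          (Formula.relabel (Sum.map (Set.rangeFactorization w) e) φ)) (m ∘ e.symm) ↔
        φ.Realize (Sum.elim w m) := by
    intro φ m
    rw [fRealize_addConsts_iff, Equiv.apply_symm_apply, FRealize, Formula.realize_relabel,
      Sum.elim_comp_map, Function.comp_assoc, Equiv.symm_comp_self]
    rfl
  refine ⟨b ∘ e, fun φ hφ => ?_⟩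
  rw [← key, Function.comp_assoc, Equiv.self_comp_symm]
  exact hb _ (hφ.mono fun m hm => (key φ m).2 hm)

/-- A family of formulas closed under conjunction, each with a solution in `S`, is contained in
the type of an ultrafilter concentrated on `S`. -/
theorem exists_ultrafilter_realize {ι X : Type*} (w : ι → U) (S : Set (X → U))
    (p : Set (L.Formula (ι ⊕ X))) (hne : p.Nonempty)
    (hinf : ∀ φ ∈ p, ∀ ψ ∈ p, φ ⊓ ψ ∈ p)
    (h : ∀ φ ∈ p, ∃ t ∈ S, φ.Realize (Sum.elim w t)) :
    ∃ F : Ultrafilter (X → U), (∀ᶠ t in F, t ∈ S) ∧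
      ∀ φ ∈ p, ∀ᶠ t in F, φ.Realize (Sum.elim w t) := by
  have : Nonempty p := hne.to_subtype
  let G : p → Filter (X → U) := fun φ => Filter.principal {t | t ∈ S ∧ φ.1.Realize (Sum.elim w t)}
  have hG : (⨅ φ, G φ).NeBot := by
    refine Filter.iInf_neBot_of_directed' ?_ ?_
    · rintro ⟨φ, hφ⟩ ⟨ψ, hψ⟩
      refine ⟨⟨φ ⊓ ψ, hinf φ hφ ψ hψ⟩, ?_, ?_⟩ <;>
      · refine Filter.principal_mono.2 fun t ht => ?_
        have := Formula.realize_inf.1 ht.2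
        exact ⟨ht.1, by tauto⟩
    · rintro ⟨φ, hφ⟩
      obtain ⟨t, htS, ht⟩ := h φ hφ
      exact Filter.principal_neBot_iff.2 ⟨t, htS, ht⟩
  have hle : ∀ φ : p, ∀ᶠ t in Ultrafilter.of (⨅ φ, G φ), t ∈ S ∧ φ.1.Realize (Sum.elim w t) :=
    fun φ => (Ultrafilter.of_le _).trans (iInf_le G φ) (Filter.mem_principal_self _)
  exact ⟨_, (hle (Classical.arbitrary p)).mono fun t ht => ht.1,
    fun φ hφ => (hle ⟨φ, hφ⟩).mono fun t ht => ht.2⟩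

/-- Dependent choice along a well-order. -/
theorem exists_seq_of_wellFoundedLT {K T : Type*} [LinearOrder K] [WellFoundedLT K] [Nonempty T]
    (Q : ∀ α : K, (Set.Iio α → T) → T → Prop)
    (h : ∀ (α : K) (s : K → T), (∀ β < α, Q β (fun γ => s γ) (s β)) →
      ∃ t, Q α (fun γ => s γ) t) :
    ∃ s : K → T, ∀ α, Q α (fun γ => s γ) (s α) := by
  let s : K → T := WellFounded.fix (wellFounded_lt (α := K)) fun α g =>
    Classical.epsilon (Q α fun γ => g γ.1 γ.2)
  have hs : ∀ α, s α = Classical.epsilon (Q α fun γ => s γ) := fun α =>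
    WellFounded.fix_eq (wellFounded_lt (α := K)) _ α
  refine ⟨s, fun α => ?_⟩
  induction α using WellFoundedLT.induction with
  | ind α ih =>
    rw [hs α]
    exact Classical.epsilon_spec (h α s ih)

/-- A relation is partial elementary if it preserves the truth of formulas in both directions. -/
def PartialElem (L : FirstOrder.Language.{u, u}) {U : Type u} [L.Structure U]
    (R : Set (U × U)) : Prop :=
  ∀ (k : ℕ) (φ : L.Formula (Fin k)) (a : Fin k → U × U), (∀ i, a i ∈ R) →
    (φ.Realize (fun i => (a i).1) ↔ φ.Realize (fun i => (a i).2))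

theorem PartialElem.realize_iff {R : Set (U × U)} (hR : PartialElem L R) {ι : Type*}
    (φ : L.Formula ι) (v w : ι → U) (h : ∀ i, (v i, w i) ∈ R) : φ.Realize v ↔ φ.Realize w := by
  classical
  let e := Fintype.equivFin φ.freeVarFinset
  have key : ∀ v : ι → U, φ.Realize v ↔
      Formula.Realize (BoundedFormula.restrictFreeVar φ e : L.Formula (Fin _))
        (fun i => v (e.symm i)) := fun v =>
    (BoundedFormula.realize_restrictFreeVar v (by simp)).symm
  rw [key v, key w]
  exact hR _ _ (fun i => (v (e.symm i), w (e.symm i))) fun i => h _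

theorem PartialElem.swap {R : Set (U × U)} (hR : PartialElem L R) :
    PartialElem L (Prod.swap ⁻¹' R) :=
  fun k φ a ha => (hR k φ (fun i => (a i).swap) ha).symm

theorem partialElem_range {ι : Type*} (v w : ι → U)
    (h : ∀ φ : L.Formula ι, φ.Realize v ↔ φ.Realize w) :
    PartialElem L (Set.range fun i => (v i, w i)) := by
  intro k φ a ha
  choose g hg using ha
  have := h (φ.relabel g)
  rw [Formula.realize_relabel, Formula.realize_relabel] at this
  simpa only [← hg, Function.comp_def] using this

theorem PartialElem.exists_insert (hsat : IsSatStr U iS) {R : Set (U × U)}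
    (hR : PartialElem L R) (hcard : #R < #U) (x : U) :
    ∃ y, PartialElem L (insert (x, y) R) := by
  obtain ⟨F, -, hF⟩ := exists_ultrafilter_realize (L := L) (ι := R) (X := Unit) (fun r => r.1.2)
    Set.univ {φ | φ.Realize (Sum.elim (fun r => r.1.1) fun _ => x)}
    ⟨⊤, Formula.realize_top.2 trivial⟩
    (fun φ hφ ψ hψ => Formula.realize_inf.2 ⟨hφ, hψ⟩) (by
      intro φ hφ
      have := (hR.realize_iff (φ.iExs Unit) (fun r : R => r.1.1) (fun r => r.1.2)
        fun r => r.2).1 (Formula.realize_iExs.2 ⟨_, hφ⟩)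
      obtain ⟨t, ht⟩ := Formula.realize_iExs.1 this
      exact ⟨t, trivial, ht⟩)
  obtain ⟨t, ht⟩ := hsat.exists_realize_s13 hcard (fun r : R => r.1.2) (F : Filter (Unit → U))
  refine ⟨t (), ?_⟩
  have hiff : ∀ φ : L.Formula (R ⊕ Unit), φ.Realize (Sum.elim (fun r => r.1.1) fun _ => x) ↔
      φ.Realize (Sum.elim (fun r => r.1.2) t) := by
    intro φ
    refine ⟨fun h => ht φ (hF φ h), fun h => ?_⟩
    by_contra hn
    exact Formula.realize_not.1 (ht φ.not (hF φ.not (Formula.realize_not.2 hn))) h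
  convert partialElem_range _ _ hiff using 1
  ext ⟨a, b⟩
  simp only [Set.mem_insert_iff, Set.mem_range, Sum.exists, Sum.elim_inl, Sum.elim_inr]
  constructor
  · rintro (h | h)
    · exact Or.inr ⟨(), h.symm⟩
    · exact Or.inl ⟨⟨_, h⟩, rfl⟩
  · rintro (⟨r, h⟩ | ⟨_, h⟩)
    · exact Or.inr (h ▸ r.2)
    · exact Or.inl h.symm

theorem PartialElem.exists_insert_insert (hsat : IsSatStr U iS) (hinf : ℵ₀ ≤ #U)
    {R : Set (U × U)} (hR : PartialElem L R) (hcard : #R < #U) (x y : U) :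
    ∃ x' y', PartialElem L (insert (x', y) (insert (x, y') R)) := by
  obtain ⟨y', h⟩ := hR.exists_insert hsat hcard x
  have hc : #(Prod.swap ⁻¹' insert (x, y') R : Set (U × U)) < #U := by
    rw [← Set.image_swap_eq_preimage_swap]
    exact (mk_image_le.trans (mk_insert_le)).trans_lt
      (add_lt_of_lt hinf hcard (one_lt_aleph0.trans_le hinf))
  obtain ⟨x', h'⟩ := h.swap.exists_insert hsat hc y
  refine ⟨x', y', ?_⟩
  convert h'.swap using 1
  ext ⟨a, b⟩
  simp [and_comm]

theorem mk_Iio_ord_toType_lt {α : Type u} (i : (#α).ord.ToType) : #(Set.Iio i) < #α := by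
  simpa using mk_Iio_lt i (by simp)

theorem PartialElem.exists_equiv {R : Set (U × U)} (hR : PartialElem L R)
    (h₁ : ∀ x, ∃ y, (x, y) ∈ R) (h₂ : ∀ y, ∃ x, (x, y) ∈ R) :
    ∃ f : U ≃[L] U, ∀ r ∈ R, f r.1 = r.2 := by
  have heq : ∀ a ∈ R, ∀ b ∈ R, a.1 = b.1 ↔ a.2 = b.2 := by
    intro a ha b hb
    have := hR.realize_iff (Term.equal (Term.var (0 : Fin 2)) (Term.var 1))
      ![a.1, b.1] ![a.2, b.2] (by intro i; fin_cases i <;> simpa)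
    simpa [Formula.realize_equal] using this
  choose f hf using h₁
  choose g hg using h₂
  have hfr : ∀ r ∈ R, f r.1 = r.2 := fun r hr => (heq _ (hf r.1) _ hr).1 rfl
  refine ⟨{ toFun := f, invFun := g, left_inv := fun x => ?_, right_inv := fun y => ?_,
            map_fun' := fun {k} F x => ?_, map_rel' := fun {k} r x => ?_ }, hfr⟩
  · exact (heq _ (hg _) _ (hf x)).2 rfl
  · exact hfr _ (hg y)
  · have := hR.realize_iff
      (Term.equal (Term.func F fun i => Term.var (some i)) (Term.var (none : Option (Fin k))))
      (fun o => o.elim (Structure.funMap F x) x)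
      (fun o => o.elim (f (Structure.funMap F x)) (f ∘ x)) (by rintro (_ | i) <;> exact hf _)
    simp only [Formula.realize_equal, Term.realize_func, Term.realize_var] at this
    exact (this.1 rfl).symm
  · have := hR.realize_iff (r.formula fun i => Term.var i) x (f ∘ x) (fun i => hf _)
    simp only [Formula.realize_rel, Term.realize_var] at this
    exact this.symm

/-- Strong homogeneity of saturated structures. -/
theorem IsSatStr.exists_equiv (hsat : IsSatStr U iS) (hinf : ℵ₀ ≤ #U) {ι : Type u}
    (hι : #ι < #U) (v w : ι → U) (h : ∀ φ : L.Formula ι, φ.Realize v ↔ φ.Realize w) :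
    ∃ f : U ≃[L] U, ∀ i, f (v i) = w i := by
  obtain ⟨e⟩ : Nonempty ((#U).ord.ToType ≃ U) := Cardinal.eq.1 (mk_ord_toType _)
  have : Nonempty U := mk_ne_zero_iff.1 (aleph0_pos.trans_le hinf).ne'
  let R₀ : Set (U × U) := Set.range fun i => (v i, w i)
  let pairs : (U × U) × (U × U) → Set (U × U) := fun t => {t.1, t.2}
  obtain ⟨s, hs⟩ := exists_seq_of_wellFoundedLT (K := (#U).ord.ToType)
    (T := (U × U) × (U × U)) (fun α g t =>
      PartialElem L (R₀ ∪ (⋃ β, pairs (g β)) ∪ pairs t) ∧ t.1.1 = e α ∧ t.2.2 = e α) (by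
    intro α s hs
    have hR : PartialElem L (R₀ ∪ ⋃ β : Set.Iio α, pairs (s β)) := by
      intro k φ a ha
      by_cases hα : ∃ β₀, β₀ < α ∧ ∀ i, a i ∈ R₀ ∪ ⋃ β : Set.Iic β₀, pairs (s β)
      · obtain ⟨β₀, hβ₀, hmem⟩ := hα
        refine (hs β₀ hβ₀).1 k φ a fun i => ?_
        rcases hmem i with h | h
        · exact Or.inl (Or.inl h)
        · obtain ⟨⟨β, hβ⟩, h⟩ := Set.mem_iUnion.1 h
          rcases (Set.mem_Iic.1 hβ).lt_or_eq with hlt | rfl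
          · exact Or.inl (Or.inr (Set.mem_iUnion.2 ⟨⟨β, hlt⟩, h⟩))
          · exact Or.inr h
      · by_cases hR₀ : ∀ i, a i ∈ R₀
        · exact partialElem_range v w h k φ a hR₀
        · exfalso
          push Not at hR₀
          obtain ⟨i₀, hi₀⟩ := hR₀
          have hex : ∀ i, ∃ β < α, a i ∈ R₀ ∪ pairs (s β) := by
            obtain ⟨⟨β₀, hβ₀⟩, -⟩ := Set.mem_iUnion.1 ((ha i₀).resolve_left hi₀)
            intro i
            rcases ha i with h | h
            · exact ⟨β₀, hβ₀, Or.inl h⟩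
            · obtain ⟨⟨β, hβ⟩, h⟩ := Set.mem_iUnion.1 h
              exact ⟨β, hβ, Or.inr h⟩
          choose B hB hBmem using hex
          have : Nonempty (Fin k) := ⟨i₀⟩
          obtain ⟨j, hj⟩ := Finite.exists_max B
          refine hα ⟨B j, hB j, fun i => (hBmem i).imp_right fun h => ?_⟩
          exact Set.mem_iUnion.2 ⟨⟨B i, hj i⟩, h⟩
    have hcard : #(R₀ ∪ ⋃ β : Set.Iio α, pairs (s β) : Set (U × U)) < #U := by
      refine (mk_union_le _ _).trans_lt (add_lt_of_lt hinf (mk_range_le.trans_lt hι) ?_)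
      have hle : (⋃ β : Set.Iio α, pairs (s β)) ⊆
          Set.range fun q : Set.Iio α × ULift.{u} Bool =>
            cond q.2.down (s q.1).1 (s q.1).2 := by
        refine Set.iUnion_subset fun β r hr => ?_
        rcases hr with rfl | hr
        · exact ⟨(β, ⟨true⟩), rfl⟩
        · exact ⟨(β, ⟨false⟩), hr.symm⟩
      refine ((mk_le_mk_of_subset hle).trans mk_range_le).trans_lt ?_
      rw [mk_prod, Cardinal.lift_id, Cardinal.lift_id]
      exact mul_lt_of_lt hinf (mk_Iio_ord_toType_lt α)
        ((lt_aleph0_of_finite _).trans_le hinf)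
    obtain ⟨x', y', hxy⟩ := hR.exists_insert_insert hsat hinf hcard (e α) (e α)
    refine ⟨((e α, y'), (x', e α)), ?_, rfl, rfl⟩
    convert hxy using 1
    ext r
    simp only [pairs, Set.mem_union, Set.mem_insert_iff, Set.mem_singleton_iff]
    tauto)
  have hR : PartialElem L (R₀ ∪ ⋃ β, pairs (s β)) := by
    intro k φ a ha
    have hex : ∀ i, ∃ β, a i ∈ R₀ ∪ pairs (s β) := by
      intro i
      rcases ha i with h | h
      · exact ⟨e.symm (Classical.arbitrary U), Or.inl h⟩
      · obtain ⟨β, h⟩ := Set.mem_iUnion.1 h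
        exact ⟨β, Or.inr h⟩
    choose B hBmem using hex
    have : Nonempty (#U).ord.ToType := ⟨e.symm (Classical.arbitrary U)⟩
    obtain ⟨β₀, hβ₀⟩ := Finite.exists_le B
    refine (hs β₀).1 k φ a fun i => ?_
    rcases hBmem i with h | h
    · exact Or.inl (Or.inl h)
    · rcases (hβ₀ i).lt_or_eq with hlt | heq
      · exact Or.inl (Or.inr (Set.mem_iUnion.2 ⟨⟨B i, hlt⟩, h⟩))
      · exact Or.inr (heq ▸ h)
  have hmem : ∀ α, pairs (s α) ⊆ R₀ ∪ ⋃ β, pairs (s β) := fun α =>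
    Set.subset_union_of_subset_right (Set.subset_iUnion (fun β => pairs (s β)) α) _
  obtain ⟨f, hf⟩ := hR.exists_equiv
    (fun x => ⟨(s (e.symm x)).1.2, hmem (e.symm x) (Or.inl
      (Prod.ext ((hs _).2.1.trans (e.apply_symm_apply x)).symm rfl))⟩)
    (fun x => ⟨(s (e.symm x)).2.1, hmem (e.symm x) (Or.inr
      (Prod.ext rfl ((hs _).2.2.trans (e.apply_symm_apply x)).symm))⟩)
  exact ⟨f, fun i => hf (v i, w i) (Or.inl ⟨i, rfl⟩)⟩

theorem IsSatStr.exists_autFix (hsat : IsSatStr U iS) (hinf : ℵ₀ ≤ #U) {A : Set U}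
    (hA : #A < #U) {X : Type} [Finite X] (a b : X → U)
    (h : ∀ φ : L.Formula (A ⊕ X), φ.Realize (Sum.elim Subtype.val a) →
      φ.Realize (Sum.elim Subtype.val b)) :
    ∃ f ∈ AutFix L U A, ⇑f ∘ a = b := by
  have hc : #(A ⊕ X) < #U := by
    rw [mk_sum, Cardinal.lift_uzero]
    refine add_lt_of_lt hinf (by simpa using hA) (lt_of_lt_of_le ?_ hinf)
    simp
  obtain ⟨f, hf⟩ := hsat.exists_equiv hinf hc (Sum.elim Subtype.val a) (Sum.elim Subtype.val b)
    fun φ => ⟨h φ, fun hb => by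
      by_contra hn
      exact Formula.realize_not.1 (h φ.not (Formula.realize_not.2 hn)) hb⟩
  exact ⟨f, fun x hx => hf (Sum.inl ⟨x, hx⟩), funext fun x => hf (Sum.inr x)⟩

theorem mem_imgSet_iff {n : ℕ} (f : U ≃[L] U) (D : Set (Fin n → U)) (c : Fin n → U) :
    c ∈ imgSet L U f D ↔ ⇑f.symm ∘ c ∈ D := by
  constructor
  · rintro ⟨b, hb, rfl⟩
    convert hb
    ext i
    simp
  · intro h
    refine ⟨_, h, ?_⟩
    ext i
    simp

theorem comp_mem_imgSet_iff {n : ℕ} (f : U ≃[L] U) (D : Set (Fin n → U)) (c : Fin n → U) :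
    ⇑f ∘ c ∈ imgSet L U f D ↔ c ∈ D := by
  rw [mem_imgSet_iff]
  convert Iff.rfl
  ext i
  simp

theorem symm_mem_autFix {A : Set U} {f : U ≃[L] U} (hf : f ∈ AutFix L U A) :
    f.symm ∈ AutFix L U A := by
  intro a ha
  conv_lhs => rw [← hf a ha]
  exact f.symm_apply_apply a

/-- Automorphisms of `U` are isomorphisms between the corresponding expansions. -/
theorem fRealize_expStr_imgSet {n : ℕ} {A : Set U} (D : Set (Fin n → U)) {f : U ≃[L] U}
    (hf : f ∈ AutFix L U A) {α : Type*} (φ : ((expLang L n)[[↥A]]).Formula α) (v : α → U) :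
    FRealize U (addConsts U (expStr L U (imgSet L U f D)) A) φ (f ∘ v) ↔
      FRealize U (addConsts U (expStr L U D) A) φ v := by
  let g : @Language.Equiv ((expLang L n)[[↥A]]) U U (addConsts U (expStr L U D) A)
      (addConsts U (expStr L U (imgSet L U f D)) A) :=
    @Language.Equiv.mk _ _ _ (addConsts U (expStr L U D) A)
      (addConsts U (expStr L U (imgSet L U f D)) A) f.toEquiv
      (fun {k} F x => by
        rcases F with (F | F) | F
        · exact f.map_fun F x
        · exact F.elim
        · cases k with
          | zero => exact hf _ F.2
          | succ k => exact isEmptyElim F)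
      (fun {k} r x => by
        rcases r with (r | r) | r
        · exact f.map_rel r x
        · exact comp_mem_imgSet_iff f D _
        · exact isEmptyElim r)
  exact @StrongHomClass.realize_formula _ U U (addConsts U (expStr L U D) A)
    (addConsts U (expStr L U (imgSet L U f D)) A) α _ _ _ g φ v

theorem indiscOver_iff {n : ℕ} (A : Set U) {I : Type*} [LinearOrder I] (a : I → Fin n → U) :
    IndiscOver L U A a ↔ ∀ (k : ℕ) (i j : Fin k → I), StrictMono i → StrictMono j →
      ∀ φ : L.Formula (A ⊕ Fin k × Fin n),
        φ.Realize (Sum.elim Subtype.val fun q => a (i q.1) q.2) ↔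
          φ.Realize (Sum.elim Subtype.val fun q => a (j q.1) q.2) := by
  constructor
  · intro h k i j hi hj φ
    have := h k i j hi hj ((BoundedFormula.constantsVarsEquiv (n := 0)).symm φ)
    rwa [fRealize_addConsts_iff, fRealize_addConsts_iff, Equiv.apply_symm_apply] at this
  · intro h k i j hi hj φ
    rw [fRealize_addConsts_iff, fRealize_addConsts_iff]
    exact h k i j hi hj _

theorem isElementary_range {M : Type*} [L.Structure M] (f : M ↪ₑ[L] U) :
    f.toEmbedding.toHom.range.IsElementary := by
  intro k φ x
  rw [← StrongHomClass.realize_formula f.toEmbedding.equivRange.symm φ (v := x),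
    ← f.map_formula φ]
  have : (f ∘ f.toEmbedding.equivRange.symm ∘ x) = Subtype.val ∘ x := by
    ext i
    exact congrArg Subtype.val (f.toEmbedding.equivRange.apply_symm_apply (x i))
  exact iff_of_eq (congrArg φ.Realize this).symm

theorem LascarInv.imgSet_eq {n : ℕ} {A : Set U} {D : Set (Fin n → U)} (h : LascarInv L U A D)
    (M : L.ElementarySubstructure U) (hAM : A ⊆ (M : Set U)) (hM : #(M : Set U) < #U) :
    ∀ C ∈ oSet L U A D, ∀ f ∈ AutFix L U (M : Set U), imgSet L U f C = C := by
  rintro _ ⟨g, hg, rfl⟩ f hf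
  let N : L.ElementarySubstructure U :=
    ⟨_, isElementary_range (g.symm.toElementaryEmbedding.comp M.subtype)⟩
  have hN : ((N : L.Substructure U) : Set U) = Set.range fun m : M => g.symm m := rfl
  have hinv := h N (by
      rw [hN]
      intro a ha
      exact ⟨⟨a, hAM ha⟩, symm_mem_autFix hg a ha⟩)
    (by rw [hN]; exact mk_range_le.trans_lt hM) ((g.symm.comp f).comp g) (by
      rw [hN]
      rintro _ ⟨m, rfl⟩
      have := hf m m.2
      simp [this])
  ext c
  have := mem_imgSet_iff ((g.symm.comp f).comp g) D (g.symm ∘ c)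
  rw [hinv] at this
  rw [mem_imgSet_iff, mem_imgSet_iff, mem_imgSet_iff, this]
  convert Iff.rfl using 2
  ext i
  apply ((g.symm.comp f).comp g).injective
  simp

theorem IsSatStr.mk_oSet_lt (hsat : IsSatStr U iS) (hinacc : Cardinal.IsInaccessible #U)
    (hcard : L.card < #U) {n : ℕ} {A M : Set U} (hM : #M < #U) {D : Set (Fin n → U)}
    (h : ∀ C ∈ oSet L U A D, ∀ f ∈ AutFix L U M, imgSet L U f C = C) :
    #(oSet L U A D) < #U := by
  have hinf := hinacc.isRegular.aleph0_le
  let tp : (Fin n → U) → Set (L.Formula (M ⊕ Fin n)) :=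
    fun a => {φ | φ.Realize (Sum.elim Subtype.val a)}
  have hinj : Function.Injective fun C : oSet L U A D => tp '' C.1 := by
    have key : ∀ C C' : oSet L U A D, tp '' C.1 = tp '' C'.1 → C.1 ⊆ C'.1 := by
      intro C C' hCC' a ha
      obtain ⟨b, hb, hab⟩ : tp a ∈ tp '' C'.1 := hCC' ▸ Set.mem_image_of_mem tp ha
      obtain ⟨f, hf, rfl⟩ := hsat.exists_autFix hinf hM b a fun φ hφ =>
        (Set.ext_iff.1 hab φ).1 hφ
      rw [← h C'.1 C'.2 f hf]
      exact Set.mem_image_of_mem _ hb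
    exact fun C C' hCC' => Subtype.ext ((key C C' hCC').antisymm (key C' C hCC'.symm))
  have hform : #(L.Formula (M ⊕ Fin n)) < #U := by
    have h1 : #(L.Formula (M ⊕ Fin n)) ≤ #(Σ k, L.BoundedFormula (M ⊕ Fin n) k) :=
      mk_le_of_injective (f := fun φ => ⟨0, φ⟩) fun φ ψ h => by simpa using h
    refine (h1.trans BoundedFormula.card_le).trans_lt (max_lt hinacc.1 ?_)
    rw [Cardinal.lift_id, Cardinal.lift_id]
    refine add_lt_of_lt hinf ?_ hcard
    rw [mk_sum]
    refine add_lt_of_lt hinf (by simpa using hM) (by simpa using hinacc.nat_lt n)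
  refine (mk_le_of_injective hinj).trans_lt ?_
  rw [mk_set, mk_set]
  exact hinacc.isStrongLimit.isStrongPrelimit (hinacc.isStrongLimit.isStrongPrelimit hform)

/-- A function on tuples with few values, compatible with automorphisms over `A`, identifies any
two tuples that start a sequence in which all increasing pairs have the same type over `A`. -/
theorem IsSatStr.eq_of_mk_lt (hsat : IsSatStr U iS) (hinacc : Cardinal.IsInaccessible #U)
    {A : Set U} (hA : #A < #U) {X : Type} [Finite X] (c : ℕ → X → U)
    (hc : ∀ p r, p < r → ∀ φ : L.Formula (A ⊕ X ⊕ X),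
      φ.Realize (Sum.elim Subtype.val (Sum.elim (c 0) (c 1))) →
        φ.Realize (Sum.elim Subtype.val (Sum.elim (c p) (c r))))
    {Γ : Type u} (hΓ : #Γ < #U) (G : (X → U) → Γ)
    (hG : ∀ f ∈ AutFix L U A, ∀ b b', G b = G b' → G (f ∘ b) = G (f ∘ b')) :
    G (c 0) = G (c 1) := by
  have hinf := hinacc.isRegular.aleph0_le
  have : Nonempty (X → U) := ⟨c 0⟩
  obtain ⟨d, hd⟩ := exists_seq_of_wellFoundedLT (K := (#U).ord.ToType) (T := X → U)
    (fun α g t => ∀ φ : L.Formula (A ⊕ X ⊕ X),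
      φ.Realize (Sum.elim Subtype.val (Sum.elim (c 0) (c 1))) →
        (∀ p, φ.Realize (Sum.elim Subtype.val (Sum.elim (c p) t))) ∧
        ∀ β, φ.Realize (Sum.elim Subtype.val (Sum.elim t (g β)))) (by
    intro α s hs
    have hι : #(A ⊕ (ℕ × X) ⊕ (Set.Iio α × X)) < #U := by
      simp only [mk_sum, mk_prod, Cardinal.lift_id, Cardinal.lift_uzero, Cardinal.lift_mul]
      have hX : Cardinal.lift.{u} #X < #U := lt_of_lt_of_le (by simp) hinf
      refine add_lt_of_lt hinf hA (add_lt_of_lt hinf (mul_lt_of_lt hinf ?_ hX)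
        (mul_lt_of_lt hinf (mk_Iio_ord_toType_lt α) hX))
      simpa using hinacc.1
    let w : A ⊕ (ℕ × X) ⊕ (Set.Iio α × X) → U :=
      Sum.elim Subtype.val (Sum.elim (fun q => c q.1 q.2) (fun q => s q.1 q.2))
    obtain ⟨t, ht⟩ := hsat.exists_realize_s13 hι w (Filter.map c Filter.atTop)
    refine ⟨t, fun φ hφ => ⟨fun p => ?_, fun β => ?_⟩⟩
    · have := ht (φ.relabel (Sum.elim (Sum.inl ∘ Sum.inl)
        (Sum.elim (fun x => Sum.inl (Sum.inr (Sum.inl (p, x)))) Sum.inr)))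
      have hv : ∀ m : X → U, Sum.elim w m ∘ (Sum.elim (Sum.inl ∘ Sum.inl)
          (Sum.elim (fun x => Sum.inl (Sum.inr (Sum.inl (p, x)))) Sum.inr)) =
          Sum.elim Subtype.val (Sum.elim (c p) m) := by
        intro m
        ext (x | x | x) <;> rfl
      simp only [Formula.realize_relabel, hv, Filter.eventually_map] at this
      exact this ((Filter.eventually_gt_atTop p).mono fun r hr => hc p r hr φ hφ)
    · have := ht (φ.relabel (Sum.elim (Sum.inl ∘ Sum.inl)
        (Sum.elim Sum.inr (fun x => Sum.inl (Sum.inr (Sum.inr (β, x)))))))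
      have hv : ∀ m : X → U, Sum.elim w m ∘ (Sum.elim (Sum.inl ∘ Sum.inl)
          (Sum.elim Sum.inr (fun x => Sum.inl (Sum.inr (Sum.inr (β, x)))))) =
          Sum.elim Subtype.val (Sum.elim m (s β)) := by
        intro m
        ext (x | x | x) <;> rfl
      simp only [Formula.realize_relabel, hv, Filter.eventually_map] at this
      exact this (Filter.Eventually.of_forall fun r => (hs β β.2 φ hφ).1 r))
  have hlt : ∀ α β, β < α → G (d α) = G (d β) → G (c 0) = G (c 1) := by
    intro α β hβα hGd
    obtain ⟨f, hf, hfd⟩ := hsat.exists_autFix hinf hA (Sum.elim (d α) (d β))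
      (Sum.elim (c 0) (c 1)) fun φ hφ => by
        by_contra hn
        exact Formula.realize_not.1
          ((hd α φ.not (Formula.realize_not.2 hn)).2 ⟨β, hβα⟩) hφ
    have h0 : f ∘ d α = c 0 := funext fun x => congrFun hfd (Sum.inl x)
    have h1 : f ∘ d β = c 1 := funext fun x => congrFun hfd (Sum.inr x)
    rw [← h0, ← h1]
    exact hG f hf _ _ hGd
  have hni : ¬ Function.Injective (G ∘ d) := fun hi =>
    ((mk_le_of_injective hi).trans_lt hΓ).ne (mk_ord_toType _)
  rw [Function.not_injective_iff] at hni
  obtain ⟨α, β, hGd, hne⟩ := hni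
  rcases hne.lt_or_gt with h | h
  · exact hlt β α h hGd.symm
  · exact hlt α β h hGd

theorem strictMono_finAppend {I : Type*} [Preorder I] {k : ℕ} {i l : Fin k → I}
    (hi : StrictMono i) (hl : StrictMono l) (h : ∀ u v, i u < l v) :
    StrictMono (Fin.append i l) := by
  intro u v huv
  induction u using Fin.addCases <;> induction v using Fin.addCases <;>
    simp only [Fin.append_left, Fin.append_right]
  · exact hi huv
  · exact h _ _
  · simp only [Fin.lt_def, Fin.val_natAdd, Fin.val_castAdd] at huv
    lia
  · exact hl (Fin.lt_def.2 (Nat.lt_of_add_lt_add_left (Fin.lt_def.1 huv)))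

theorem IsSatStr.indiscIn_expStr (hsat : IsSatStr U iS) (hinacc : Cardinal.IsInaccessible #U)
    {n : ℕ} {A : Set U} (hA : #A < #U) {D : Set (Fin n → U)} (hD : #(oSet L U A D) < #U)
    {I : Type*} [LinearOrder I] [Nonempty I] [NoMaxOrder I] {a : I → Fin n → U}
    (ha : IndiscOver L U A a) : IndiscIn U (addConsts U (expStr L U D) A) a := by
  intro k i j hi hj ψ
  rw [indiscOver_iff] at ha
  obtain ⟨M, hM⟩ := Finite.exists_le (Sum.elim i j)
  obtain ⟨M', hM'⟩ := exists_gt M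
  obtain ⟨s, hs, rfl⟩ := Nat.exists_strictMono' M'
  have key : ∀ l : Fin k → I, StrictMono l → (∀ u, l u < s 0) →
      (FRealize U (addConsts U (expStr L U D) A) ψ (fun q => a (l q.1) q.2) ↔
        FRealize U (addConsts U (expStr L U D) A) ψ (fun q => a (s q.1) q.2)) := by
    intro l hl hls
    let block : ℕ → Fin k → I := fun p => Nat.casesOn p l fun p u => s (p * k + u)
    have hmono : ∀ p, StrictMono (block p) := by
      rintro (_ | p)
      · exact hl
      · intro u v huv
        exact hs (by simpa using huv)
    have hlt : ∀ p r, p < r → ∀ u v, block p u < block r v := by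
      rintro (_ | p) (_ | r) hpr u v
      · exact absurd hpr (lt_irrefl _)
      · exact (hls u).trans_le (hs.monotone (Nat.zero_le _))
      · exact absurd hpr (Nat.not_lt_zero _)
      · refine hs ?_
        have : (p + 1) * k ≤ r * k := Nat.mul_le_mul_right _ (by lia)
        have := u.2
        grind
    let c : ℕ → Fin k × Fin n → U := fun p q => a (block p q.1) q.2
    let S : (Fin k × Fin n → U) → Set (oSet L U A D) := fun b =>
      {C | FRealize U (addConsts U (expStr L U C.1) A) ψ b}
    have hc : S (c 0) = S (c 1) := by
      refine hsat.eq_of_mk_lt hinacc hA c ?_ ?_ S ?_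
      · intro p r hpr φ
        have := ha (k + k) _ _
          (strictMono_finAppend (hmono 0) (hmono 1) (hlt 0 1 Nat.zero_lt_one))
          (strictMono_finAppend (hmono p) (hmono r) (hlt p r hpr))
          (φ.relabel (Sum.map id (Sum.elim (Prod.map (Fin.castAdd k) id)
            (Prod.map (Fin.natAdd k) id))))
        have hv : ∀ p r, (Sum.elim Subtype.val fun q : Fin (k + k) × Fin n =>
            a (Fin.append (block p) (block r) q.1) q.2) ∘
            (Sum.map id (Sum.elim (Prod.map (Fin.castAdd k) id) (Prod.map (Fin.natAdd k) id))) =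
            (Sum.elim Subtype.val (Sum.elim (c p) (c r)) : A ⊕ _ → U) := by
          intro p r
          ext (x | x | x)
          · rfl
          · exact congrFun (congrArg a (Fin.append_left _ _ _)) _
          · exact congrFun (congrArg a (Fin.append_right _ _ _)) _
        rw [Formula.realize_relabel, Formula.realize_relabel, hv, hv] at this
        exact this.1
      · rw [mk_set]
        exact hinacc.isStrongLimit.isStrongPrelimit hD
      · intro f hf b b' hbb'
        ext ⟨C, g, hg, rfl⟩
        have hD' : imgSet L U f (imgSet L U (f.symm.comp g) D) = imgSet L U g D := by
          ext e
          simp only [mem_imgSet_iff]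
          convert Iff.rfl using 2
          ext u
          apply (f.symm.comp g).injective
          simp
        have hmem : imgSet L U (f.symm.comp g) D ∈ oSet L U A D :=
          ⟨_, fun x hx => by
            rw [Language.Equiv.comp_apply, hg x hx, symm_mem_autFix hf x hx], rfl⟩
        have := Set.ext_iff.1 hbb' ⟨_, hmem⟩
        simp only [S, Set.mem_ofPred_eq] at this ⊢
        rw [← hD', fRealize_expStr_imgSet _ hf, fRealize_expStr_imgSet _ hf, this]
    have hDmem : D ∈ oSet L U A D :=
      ⟨Language.Equiv.refl L U, fun _ _ => rfl, by
        ext e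
        exact mem_imgSet_iff _ _ _⟩
    have := Set.ext_iff.1 hc ⟨D, hDmem⟩
    simpa [S, c, block] using this
  rw [key i hi fun u => (hM (Sum.inl u)).trans_lt hM',
    key j hj fun u => (hM (Sum.inr u)).trans_lt hM']

theorem mem_iff_of_indiscIn_expStr {n : ℕ} {A : Set U} {D : Set (Fin n → U)}
    (h : ∀ (I : Type u) (_ : LinearOrder I) (_ : Nonempty I) (_ : NoMaxOrder I)
      (a : I → Fin n → U), IndiscOver L U A a → IndiscIn U (addConsts U (expStr L U D) A) a)
    (c : ℕ → Fin n → U) (hc : IndiscOver L U A c) : c 0 ∈ D ↔ c 1 ∈ D := by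
  have hno : NoMaxOrder (ULift.{u} ℕ) := ⟨fun x => ⟨⟨x.down + 1⟩, Nat.lt_succ_self x.down⟩⟩
  have hind := h (ULift.{u} ℕ) inferInstance inferInstance hno (fun i => c i.down)
    (fun k i j hi hj => hc k (fun u => (i u).down) (fun u => (j u).down) hi hj)
  let r : ((expLang L n)[[↥A]]).Relations n := Sum.inl (Sum.inr ⟨⟨rfl⟩⟩)
  exact hind 1 (fun _ => ⟨0⟩) (fun _ => ⟨1⟩) (Subsingleton.strictMono _)
    (Subsingleton.strictMono _) (r.formula fun t => Term.var ((0 : Fin 1), t))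

/-- The tuple `t` realizes the average type of the filter `F` over the set `B`. -/
def RealizesAvg (L : FirstOrder.Language.{u, u}) {U : Type u} [L.Structure U] {X : Type}
    (F : Filter (X → U)) (B : Set U) (t : X → U) : Prop :=
  ∀ φ : L.Formula (B ⊕ X),
    (∀ᶠ m in F, φ.Realize (Sum.elim Subtype.val m)) → φ.Realize (Sum.elim Subtype.val t)

theorem RealizesAvg.realize_iff {X : Type} {F : Ultrafilter (X → U)} {B : Set U} {t : X → U}
    (h : RealizesAvg L F B t) {ι : Type*} (w : ι → U) (hw : ∀ i, w i ∈ B)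
    (φ : L.Formula (ι ⊕ X)) :
    φ.Realize (Sum.elim w t) ↔ ∀ᶠ m in F, φ.Realize (Sum.elim w m) := by
  have key : ∀ φ : L.Formula (ι ⊕ X), (∀ᶠ m in F, φ.Realize (Sum.elim w m)) →
      φ.Realize (Sum.elim w t) := by
    intro φ hφ
    have := h (φ.relabel (Sum.map (fun i => ⟨w i, hw i⟩) id))
    simp only [Formula.realize_relabel, Sum.elim_comp_map, Function.comp_id] at this
    exact this hφ
  refine ⟨fun ht => ?_, key φ⟩
  by_contra hn
  rw [← Ultrafilter.eventually_not] at hn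
  exact Formula.realize_not.1 (key φ.not (hn.mono fun m hm => Formula.realize_not.2 hm)) ht

theorem RealizesAvg.mono {X : Type} {F : Filter (X → U)} {B C : Set U} {t : X → U}
    (h : RealizesAvg L F C t) (hBC : B ⊆ C) : RealizesAvg L F B t := by
  intro φ hφ
  have := h (φ.relabel (Sum.map (Set.inclusion hBC) id))
  simp only [Formula.realize_relabel, Sum.elim_comp_map, Function.comp_id] at this
  exact this hφ

/-- A sequence of realizations of a type finitely satisfiable in `M` over `M` and the preceding
terms is indiscernible over subsets of `M`. -/
theorem indiscOver_of_realizesAvg {n : ℕ} {A M : Set U} (hAM : A ⊆ M)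
    {F : Ultrafilter (Fin n → U)} (hF : ∀ᶠ m : Fin n → U in F, ∀ i, m i ∈ M) (s : ℕ → Fin n → U)
    (hs : ∀ j, RealizesAvg L F (M ∪ ⋃ i : Set.Iio j, Set.range (s i)) (s j)) :
    IndiscOver L U A s := by
  suffices h : ∀ (k : ℕ) (i j : Fin k → ℕ), StrictMono i → StrictMono j →
      ∀ φ : L.Formula (M ⊕ Fin k × Fin n),
        φ.Realize (Sum.elim Subtype.val fun q => s (i q.1) q.2) ↔
          φ.Realize (Sum.elim Subtype.val fun q => s (j q.1) q.2) by
    rw [indiscOver_iff]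
    intro k i j hi hj φ
    have := h k i j hi hj (φ.relabel (Sum.map (Set.inclusion hAM) id))
    simp only [Formula.realize_relabel, Sum.elim_comp_map, Function.comp_id] at this
    exact this
  intro k
  induction k with
  | zero =>
    intro i j _ _ φ
    rw [Subsingleton.elim i j]
  | succ k ih =>
    intro i j hi hj φ
    let σ : M ⊕ Fin (k + 1) × Fin n → (M ⊕ Fin k × Fin n) ⊕ Fin n :=
      Sum.elim (Sum.inl ∘ Sum.inl)
        fun q => Fin.lastCases (motive := fun _ => (M ⊕ Fin k × Fin n) ⊕ Fin n) (Sum.inr q.2)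
          (fun u => Sum.inl (Sum.inr (u, q.2))) q.1
    have key : ∀ i : Fin (k + 1) → ℕ, StrictMono i →
        (φ.Realize (Sum.elim Subtype.val fun q => s (i q.1) q.2) ↔
          ∀ᶠ m in F, (φ.relabel σ).Realize
            (Sum.elim (Sum.elim Subtype.val fun q => s (i (Fin.castSucc q.1)) q.2) m)) := by
      intro i hi
      rw [← (hs (i (Fin.last k))).realize_iff, Formula.realize_relabel]
      · refine iff_of_eq (congrArg φ.Realize ?_)
        ext (x | ⟨u, x⟩)
        · rfl
        · induction u using Fin.lastCases <;> simp [σ]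
      · rintro (x | ⟨u, x⟩)
        · exact Or.inl x.2
        · exact Or.inr (Set.mem_iUnion.2
            ⟨⟨i u.castSucc, hi (Fin.castSucc_lt_last u)⟩, Set.mem_range_self x⟩)
    rw [key i hi, key j hj]
    refine Filter.eventually_congr (hF.mono fun m hm => ?_)
    have := ih (fun u => i u.castSucc) (fun u => j u.castSucc)
      (hi.comp (Fin.strictMono_castSucc)) (hj.comp (Fin.strictMono_castSucc))
      ((φ.relabel σ).relabel (Sum.elim id fun x => Sum.inl ⟨m x, hm x⟩))
    have hv : ∀ g : Fin k × Fin n → U, (Sum.elim Subtype.val g : M ⊕ _ → U) ∘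
        (Sum.elim id fun x => Sum.inl ⟨m x, hm x⟩) = Sum.elim (Sum.elim Subtype.val g) m := by
      intro g
      ext (x | x) <;> rfl
    simp only [Formula.realize_relabel (φ := φ.relabel σ), hv] at this
    exact this

/-- A type over a model is contained in the average type of an ultrafilter on the model. -/
theorem exists_ultrafilter_realizesAvg (M : L.ElementarySubstructure U) {X : Type} [Finite X]
    (a : X → U) :
    ∃ F : Ultrafilter (X → U), (∀ᶠ m : X → U in F, ∀ i, m i ∈ (M : Set U)) ∧
      RealizesAvg L F (M : Set U) a := by
  obtain ⟨F, hFM, hF⟩ := exists_ultrafilter_realize (L := L) (ι := (M : Set U)) (X := X)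
    Subtype.val {m : X → U | ∀ i, m i ∈ (M : Set U)} {φ | φ.Realize (Sum.elim Subtype.val a)}
    ⟨⊤, Formula.realize_top.2 trivial⟩
    (fun φ hφ ψ hψ => Formula.realize_inf.2 ⟨hφ, hψ⟩) (by
      intro φ hφ
      have h : (φ.iExs X).Realize (M.subtype ∘ fun m : M => m) := Formula.realize_iExs.2 ⟨a, hφ⟩
      rw [M.subtype.map_formula] at h
      obtain ⟨t, ht⟩ := Formula.realize_iExs.1 h
      refine ⟨M.subtype ∘ t, fun i => (t i).2, ?_⟩
      rw [← M.subtype.map_formula] at ht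
      convert ht using 1
      ext (x | x) <;> rfl)
  refine ⟨F, hFM, fun φ hφ => ?_⟩
  by_contra hn
  obtain ⟨m, hm, hm'⟩ := (hφ.and (hF φ.not (Formula.realize_not.2 hn))).exists
  exact Formula.realize_not.1 hm' hm

theorem IsSatStr.lascarInv (hsat : IsSatStr U iS) (hinf : ℵ₀ < #U) {n : ℕ} {A : Set U}
    {D : Set (Fin n → U)}
    (h : ∀ c : ℕ → Fin n → U, IndiscOver L U A c → (c 0 ∈ D ↔ c 1 ∈ D)) :
    LascarInv L U A D := by
  intro M hAM hM
  have key : ∀ f ∈ AutFix L U (M : Set U), ∀ a, a ∈ D → ⇑f ∘ a ∈ D := by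
    intro f hf a haD
    obtain ⟨F, hFM, hFa⟩ := exists_ultrafilter_realizesAvg M a
    have hFb : RealizesAvg L F (M : Set U) (f ∘ a) := by
      intro φ hφ
      have := (StrongHomClass.realize_formula f φ).2 (hFa φ hφ)
      convert this using 1
      ext (x | x)
      · exact (hf x x.2).symm
      · rfl
    let P : Set U := Set.range a ∪ Set.range (f ∘ a)
    have hP : #P < #U := (lt_aleph0_of_finite P).trans hinf
    have : Nonempty (Fin n → U) := ⟨a⟩
    obtain ⟨c, hc⟩ := exists_seq_of_wellFoundedLT (K := ℕ) (T := Fin n → U)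
      (fun i g t => RealizesAvg L F ((M : Set U) ∪ (P ∪ ⋃ j, Set.range (g j))) t) (by
      intro i s _
      refine hsat.exists_realize_s13 ?_ Subtype.val (F : Filter (Fin n → U))
      refine (mk_union_le _ _).trans_lt (add_lt_of_lt hinf.le hM ((lt_aleph0_of_finite _).trans hinf)))
    have hind : ∀ b, Set.range b ⊆ P → RealizesAvg L F (M : Set U) b → (b ∈ D ↔ c 0 ∈ D) := by
      intro b hbP hb
      refine h (fun i : ℕ => Nat.casesOn i b c) (indiscOver_of_realizesAvg hAM hFM _ ?_)
      rintro (_ | j)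
      · refine hb.mono (Set.union_subset Set.Subset.rfl (Set.iUnion_subset ?_))
        rintro ⟨i, hi⟩
        exact absurd hi (Nat.not_lt_zero i)
      · refine (hc j).mono (Set.union_subset_union_right _ (Set.iUnion_subset ?_))
        rintro ⟨_ | i, hi⟩
        · exact Set.subset_union_of_subset_left hbP _
        · exact Set.subset_union_of_subset_right (Set.subset_iUnion
            (fun i : Set.Iio j => Set.range (c i)) ⟨i, Nat.lt_of_succ_lt_succ hi⟩) _
    exact (hind _ Set.subset_union_right hFb).2
      ((hind _ Set.subset_union_left hFa).1 haD)
  intro f hf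
  ext e
  rw [mem_imgSet_iff]
  refine ⟨fun he => ?_, fun he => key _ (symm_mem_autFix hf) e he⟩
  have := key f hf _ he
  convert this
  ext i
  simp

end Auxiliary

/-- for `A ⊆ M ⪯ U` small, the five characterizations of Lascar invariance
of `D` over `A` are equivalent. -/
theorem stmt13 (L : FirstOrder.Language.{u, u}) (U : Type u) [iS : L.Structure U]
    (hsat : IsSatStr U iS) (hinacc : Cardinal.IsInaccessible #U) (hcard : L.card < #U)
    (n : ℕ) (D : Set (Fin n → U)) (A : Set U) (hA : #A < #U)
    (M : L.ElementarySubstructure U) (hAM : A ⊆ (M : Set U)) (hM : #(M : Set U) < #U) :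
    ((LascarInv L U A D ↔
        ∀ C ∈ oSet L U A D, ∀ f ∈ AutFix L U (M : Set U), imgSet L U f C = C) ∧
      ((∀ C ∈ oSet L U A D, ∀ f ∈ AutFix L U (M : Set U), imgSet L U f C = C) ↔
        #(oSet L U A D) < #U)) ∧
    ((#(oSet L U A D) < #U ↔
        ∀ (I : Type u) (_ : LinearOrder I) (_ : Nonempty I) (_ : NoMaxOrder I)
          (a : I → Fin n → U), IndiscOver L U A a →
            IndiscIn U (addConsts U (expStr L U D) A) a) ∧
      ((∀ (I : Type u) (_ : LinearOrder I) (_ : Nonempty I) (_ : NoMaxOrder I)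
          (a : I → Fin n → U), IndiscOver L U A a →
            IndiscIn U (addConsts U (expStr L U D) A) a) ↔
        ∀ c : ℕ → Fin n → U, IndiscOver L U A c → (c 0 ∈ D ↔ c 1 ∈ D))) := by
  have h12 := fun h : LascarInv L U A D => h.imgSet_eq M hAM hM
  have h23 := hsat.mk_oSet_lt (D := D) (A := A) hinacc hcard hM
  have h34 := fun (h : #(oSet L U A D) < #U) (I : Type u) (_ : LinearOrder I) (_ : Nonempty I)
    (_ : NoMaxOrder I) (a : I → Fin n → U) (ha : IndiscOver L U A a) =>
      hsat.indiscIn_expStr hinacc hA h ha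
  have h45 := mem_iff_of_indiscIn_expStr (L := L) (A := A) (D := D)
  have h51 := hsat.lascarInv hinacc.1 (A := A) (D := D)
  exact ⟨⟨⟨h12, fun h => h51 (h45 (h34 (h23 h)))⟩, ⟨h23, fun h => h12 (h51 (h45 (h34 h)))⟩⟩,
    ⟨⟨h34, fun h => h23 (h12 (h51 (h45 h)))⟩, ⟨h45, fun h => h34 (h23 (h12 (h51 h)))⟩⟩⟩

end Paper
end
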